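/- Let K be a field with algebraic closure K̄, and let X be a separated scheme of finite type over K whose underlying topological space is irreducible and has Krull dimension at least 1, and let x̄_1, …, x̄_n : Spec K̄ → X be K̄-points of X over K. Write X_K̄ = X ×_{Spec K} Spec K̄ and let p : |X_K̄| → |X| be the projection. Then there exists a closed irreducible subset C of |X| of Krull dimension 1 containing the images of all x̄_i, with the additional property that there is a bijection φ from the set of irreducible components of p⁻¹(C) to the set of irreducible components of |X_K̄| such that every irreducible component Z of p⁻¹(C) is contained in φ(Z), and every irreducible component of |X_K̄| contains exactly one irreducible component of p⁻¹(C). -/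

import Mathlib

universe u

/-- `s` is an irreducible component of the subset `A` of a topological space,
i.e. a maximal irreducible subset of `A`. -/
def IsIrreducibleComponentIn {α : Type*} [TopologicalSpace α] (A s : Set α) : Prop :=
  s ⊆ A ∧ IsIrreducible s ∧ ∀ t : Set α, t ⊆ A → IsIrreducible t → s ⊆ t → t = s

section
open Polynomial

namespace Hit

/-- Newton approximation. -/
theorem newton {A : Type*} [CommRing A] (J : Ideal A) (f : A[X]) (z0 g : A)
    (h0 : f.eval z0 ∈ J) (hg : g * f.derivative.eval z0 - 1 ∈ J) (k : ℕ) :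
    ∃ z, z - z0 ∈ J ∧ f.eval z ∈ J ^ k := by
  induction k with
  | zero => exact ⟨z0, by simp, by simp⟩
  | succ k ih =>
    rcases k with _ | k
    · exact ⟨z0, by simp, by simpa using h0⟩
    obtain ⟨z, hz, hfz⟩ := ih
    refine ⟨z - g * f.eval z, ?_, ?_⟩
    · have h1 : f.eval z ∈ J := Ideal.pow_le_self (by omega) hfz
      have := J.sub_mem hz (J.mul_mem_left g h1)
      convert this using 1; ring
    · obtain ⟨c, hc⟩ := f.binomExpansion z (- (g * f.eval z))
      rw [sub_eq_add_neg, hc]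
      have h2 : f.derivative.eval z - f.derivative.eval z0 ∈ J := by
        have := f.derivative.sub_dvd_eval_sub z z0
        exact J.mem_of_dvd this hz
      have h3 : 1 - g * f.derivative.eval z ∈ J := by
        have := J.neg_mem (J.add_mem hg (J.mul_mem_left g h2))
        convert this using 1; ring
      have h4 : eval z f * (1 - g * f.derivative.eval z) ∈ J ^ (k+1+1) := by
        rw [pow_succ]; exact Ideal.mul_mem_mul hfz h3
      have h5 : eval z f * eval z f ∈ J ^ (k+1+1) := by
        rw [pow_succ]; exact Ideal.mul_mem_mul hfz (Ideal.pow_le_self (by omega) hfz)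
      have := Ideal.add_mem _ h4 (Ideal.mul_mem_left _ (c * g^2) h5)
      convert this using 1; ring

/-- Irreducibility after an affine change of the parameter over the fraction field. -/
theorem irr_shift {O : Type*} [CommRing O] [IsDomain O] [UniqueFactorizationMonoid O]
    (E : Type*) [Field E] [Algebra O E] [IsFractionRing O E]
    (F : O[X][X]) (hF : F.Monic) (hi : Irreducible F) (u v : O) (hv : v ≠ 0) :
    Irreducible (F.map (eval₂RingHom (C.comp (algebraMap O E))
      (C (algebraMap O E u) + C (algebraMap O E v) * X))) := by
  let L := FractionRing O[X]
  have hirr : Irreducible (F.map (algebraMap O[X] L)) :=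
    (Polynomial.Monic.irreducible_iff_irreducible_map_fraction_map hF).1 hi
  have hinj : Function.Injective ((algebraMap O[X] L).comp (C : O →+* O[X])) :=
    (IsFractionRing.injective O[X] L).comp C_injective
  let e : E →+* L := IsFractionRing.lift hinj
  have he : ∀ r : O, e (algebraMap O E r) = algebraMap O[X] L (C r) := fun r =>
    IsFractionRing.lift_algebraMap hinj r
  have hv' : algebraMap O[X] L (C v) ≠ 0 := by
    intro h; exact hv (hinj (by simpa using h))
  let θ : E[X] →+* L := eval₂RingHom e
    ((algebraMap O[X] L X - algebraMap O[X] L (C u)) / algebraMap O[X] L (C v))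
  have hθ : θ.comp (eval₂RingHom (C.comp (algebraMap O E))
      (C (algebraMap O E u) + C (algebraMap O E v) * X)) = algebraMap O[X] L := by
    apply Polynomial.ringHom_ext
    · intro a; simp [θ, he]
    · simp only [RingHom.comp_apply, coe_eval₂RingHom, eval₂_X, map_add, map_mul, θ, eval₂_C, he]
      rw [mul_div_cancel₀ _ hv']; ring
  refine Polynomial.Monic.irreducible_of_irreducible_map θ _ (hF.map _) ?_
  rw [Polynomial.map_map, hθ]; exact hirr

/-- degree bound for coefficients of factors -/
theorem coeff_degree_le {A : Type*} [CommRing A] [IsDomain A] (G H : A[X][X]) (hG : G ≠ 0)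
    (hH : H ≠ 0) (D : ℕ)
    (hD : ∀ l, ((G * H).coeff l).natDegree ≤ D) (l : ℕ) : (G.coeff l).natDegree ≤ D := by
  have key : ∀ P : A[X][X], ∀ i l, ((Polynomial.Bivariate.swap P).coeff i).coeff l
      = (P.coeff l).coeff i := fun P i l => by
    induction P using Polynomial.induction_on' with
    | add p q hp hq => simp [hp, hq]
    | monomial n f =>
      induction f using Polynomial.induction_on' with
      | add p q hp hq =>
        rw [map_add, map_add, coeff_add, coeff_add, hp, hq, coeff_add, coeff_add]
      | monomial m r =>
        rw [Bivariate.swap_monomial_monomial]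
        simp only [coeff_monomial]
        split_ifs <;> simp_all [coeff_monomial]
  have h1 : (Bivariate.swap (R := A) (G * H)).natDegree ≤ D := by
    rw [natDegree_le_iff_coeff_eq_zero]
    intro i hi
    ext l
    rw [key]
    simpa using coeff_eq_zero_of_natDegree_lt (lt_of_le_of_lt (hD l) hi)
  have hG' : Bivariate.swap (R := A) G ≠ 0 := by simpa using hG
  have hH' : Bivariate.swap (R := A) H ≠ 0 := by simpa using hH
  rw [map_mul, natDegree_mul hG' hH'] at h1
  rw [natDegree_le_iff_coeff_eq_zero]
  intro i hi
  rw [← key, coeff_eq_zero_of_natDegree_lt (p := Bivariate.swap G) (by omega)]; simp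

end Hit

end

section
open Polynomial

namespace Hit

theorem eq_prod_of_roots {A ι : Type*} [CommRing A] (G : A[X]) (hG : G.Monic) (I : Finset ι)
    (r : ι → A) (hr : ∀ i ∈ I, G.eval (r i) = 0)
    (hu : ∀ i ∈ I, ∀ j ∈ I, i ≠ j → IsUnit (r i - r j)) (hc : G.natDegree ≤ I.card) :
    G = ∏ i ∈ I, (X - C (r i)) := by
  rcases subsingleton_or_nontrivial A with hs | hn
  · exact Subsingleton.elim _ _
  · apply Polynomial.eq_of_monic_of_dvd_of_natDegree_le
      (monic_prod_of_monic _ _ fun _ _ => monic_X_sub_C _) hG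
    · apply Finset.prod_dvd_of_coprime
      · intro i hi j hj hij
        exact isCoprime_X_sub_C_of_isUnit_sub (hu i hi j hj hij)
      · intro i hi
        exact dvd_iff_isRoot.2 (hr i hi)
    · rw [natDegree_prod_of_monic _ _ fun _ _ => monic_X_sub_C _]
      simpa using hc

theorem approx {Λ : Type*} [Field Λ] [IsAlgClosed Λ] [DecidableEq Λ] (α : Λ) (f : Λ[X][X][X])
    (sep : ∀ ζ, (f.map ((evalRingHom α).comp (evalRingHom 0))).eval ζ = 0 →
      (f.map ((evalRingHom α).comp (evalRingHom 0))).derivative.eval ζ ≠ 0) (k : ℕ) :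
    ∃ z : Λ → Λ[X][X], ∀ x : Λ[X], x.eval α = 0 → ∀ G H : Λ[X][X], G.Monic → H.Monic →
      G * H = f.map (evalRingHom x) → ∀ l, (X - C α) ^ k ∣
        G.coeff l - eval x ((∏ ζ ∈ (G.map (evalRingHom α)).roots.toFinset,
          (X - C (z ζ))).coeff l) := by
  set ε : Λ[X][X] →+* Λ := (evalRingHom α).comp (evalRingHom 0) with hε
  set J := RingHom.ker ε with hJ
  have hεC : ∀ a : Λ, ε (C (C a)) = a := fun a => by simp [hε]
  have hev : ∀ (g : Λ[X][X][X]) (y : Λ[X][X]), ε (g.eval y) = (g.map ε).eval (ε y) := by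
    intro g y; rw [eval_map, eval₂_hom]
  have hz : ∀ ζ : Λ, ∃ z : Λ[X][X], (f.map ε).eval ζ = 0 → ε z = ζ ∧ f.eval z ∈ J ^ k := by
    intro ζ
    by_cases h : (f.map ε).eval ζ = 0
    · obtain ⟨z, h1, h2⟩ := newton J f (C (C ζ))
        (C (C ((f.map ε).derivative.eval ζ)⁻¹)) (by
          rw [hJ, RingHom.mem_ker, hev, hεC, h]) (by
          rw [hJ, RingHom.mem_ker, map_sub, map_mul, hεC, hev, hεC, map_one, ← derivative_map,
            inv_mul_cancel₀ (sep ζ h), sub_self]) k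
      refine ⟨z, fun _ => ⟨?_, h2⟩⟩
      rw [hJ, RingHom.mem_ker, map_sub, hεC] at h1
      exact sub_eq_zero.1 h1
    · exact ⟨0, fun h' => absurd h' h⟩
  choose z hz using hz
  refine ⟨z, ?_⟩
  intro x hx G H hG hH hGH
  set P : Λ[X] := X - C α with hP
  have hevx : ∀ q : Λ[X][X], eval α (eval x q) = ε q := by
    intro q
    have : (evalRingHom α).comp (evalRingHom x) = ε := by
      apply Polynomial.ringHom_ext
      · intro a; simp [hε]
      · simp [hε, hx]
    exact congrArg (fun φ : Λ[X][X] →+* Λ => φ q) this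
  have hPdvd : ∀ q : Λ[X], P ∣ q ↔ eval α q = 0 := fun q => dvd_iff_isRoot
  set Gb := G.map (evalRingHom α) with hGb
  set Hb := H.map (evalRingHom α) with hHb
  have hfb : Gb * Hb = f.map ε := by
    rw [hGb, hHb, ← Polynomial.map_mul, hGH, Polynomial.map_map]
    congr 1
    exact RingHom.ext hevx
  have hGbm : Gb.Monic := hG.map _
  have hroot : ∀ ζ, Gb.eval ζ = 0 → (f.map ε).eval ζ = 0 := by
    intro ζ h; rw [← hfb, eval_mul, h, zero_mul]
  have hsep : Gb.Separable := by
    have h1 : (f.map ε).Separable := by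
      rw [Polynomial.Separable]
      by_contra hc
      have hne : f.map ε ≠ 0 := by
        rw [← hfb]; exact mul_ne_zero hGbm.ne_zero (hH.map _).ne_zero
      rw [Polynomial.isCoprime_iff_aeval_ne_zero_of_isAlgClosed Λ Λ] at hc
      push Not at hc
      obtain ⟨a, h1, h2⟩ := hc
      simp at h1 h2
      exact sep a h1 (by simpa [derivative_map] using h2)
    rw [← hfb] at h1; exact h1.of_mul_left
  have hcard : Gb.roots.toFinset.card = G.natDegree := by
    rw [Multiset.toFinset_card_of_nodup (nodup_roots hsep),
      IsAlgClosed.card_roots_eq_natDegree]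
    exact hG.natDegree_map _
  set I := Gb.roots.toFinset with hI
  have hIroot : ∀ ζ ∈ I, Gb.eval ζ = 0 := by
    intro ζ h; rw [hI, Multiset.mem_toFinset, mem_roots hGbm.ne_zero] at h; exact h
  let m : Ideal Λ[X] := Ideal.span {P ^ k}
  let q := Ideal.Quotient.mk m
  have hunit : ∀ y : Λ[X], eval α y ≠ 0 → IsUnit (q y) := by
    intro y hy
    have hc : IsCoprime (P ^ k) y := by
      apply IsCoprime.pow_left
      rw [Irreducible.coprime_iff_not_dvd (irreducible_X_sub_C α)]
      rwa [hPdvd]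
    obtain ⟨a, b, hab⟩ := hc
    refine IsUnit.of_mul_eq_one (q b) ?_
    have : q (a * P ^ k + b * y) = q 1 := by rw [hab]
    rw [map_add, map_mul, map_mul, map_one] at this
    have h0 : q (P ^ k) = 0 := Ideal.Quotient.eq_zero_iff_mem.2 (Ideal.mem_span_singleton_self _)
    rw [h0, mul_zero, zero_add] at this
    rw [mul_comm]; exact this
  have heq : G.map q = ∏ ζ ∈ I, (X - C (q (eval x (z ζ)))) := by
    apply eq_prod_of_roots _ (hG.map q) I (fun ζ => q (eval x (z ζ)))
    rotate_left
    · intro ζ1 h1 ζ2 h2 h12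
      rw [← map_sub]
      apply hunit
      rw [eval_sub, hevx, hevx, (hz ζ1 (hroot _ (hIroot _ h1))).1,
        (hz ζ2 (hroot _ (hIroot _ h2))).1]
      exact sub_ne_zero.2 h12
    · rw [hcard]; exact natDegree_map_le
    · intro ζ h
      rw [eval_map, eval₂_hom]
      obtain ⟨hz1, hz2⟩ := hz ζ (hroot _ (hIroot _ h))
      have hmem : P ^ k ∣ G.eval (eval x (z ζ)) * H.eval (eval x (z ζ)) := by
        rw [← eval_mul, hGH, eval_map]
        have hh : eval₂ (evalRingHom x) (eval x (z ζ)) f = evalRingHom x (f.eval (z ζ)) := by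
          rw [← coe_evalRingHom x, eval₂_hom]
        rw [hh]
        have : Ideal.map (evalRingHom x) (J ^ k) ≤ Ideal.span {P ^ k} := by
          rw [Ideal.map_pow, ← Ideal.span_singleton_pow]
          apply Ideal.pow_right_mono
          rw [Ideal.map_le_iff_le_comap]
          intro y hy
          rw [Ideal.mem_comap, Ideal.mem_span_singleton, hPdvd]
          rw [coe_evalRingHom, hevx]; exact hy
        exact Ideal.mem_span_singleton.1 (this (Ideal.mem_map_of_mem _ hz2))
      have hHne : eval α (H.eval (eval x (z ζ))) ≠ 0 := by
        have e1 : eval α (H.eval (eval x (z ζ))) = Hb.eval ζ := by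
          rw [← coe_evalRingHom α, ← eval₂_hom, coe_evalRingHom, hevx, hz1, hHb, eval_map]
        rw [e1]
        intro h0
        apply sep ζ (hroot _ (hIroot _ h))
        rw [← hfb, derivative_mul, eval_add, eval_mul, eval_mul, h0, hIroot _ h]; simp
      have : q (G.eval (eval x (z ζ))) * q (H.eval (eval x (z ζ))) = 0 := by
        rw [← map_mul]; exact Ideal.Quotient.eq_zero_iff_mem.2 (Ideal.mem_span_singleton.2 hmem)
      exact ((hunit _ hHne).mul_left_eq_zero).1 this
  intro l
  rw [← Ideal.mem_span_singleton, ← Ideal.Quotient.eq_zero_iff_mem]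
  change q _ = 0
  rw [map_sub, ← coeff_map, heq, sub_eq_zero]
  have : ∏ ζ ∈ I, (X - C (q (eval x (z ζ)))) =
      (∏ ζ ∈ I, (X - C (z ζ))).map (q.comp (evalRingHom x)) := by
    rw [Polynomial.map_prod]; simp
  rw [this, coeff_map]; rfl

/-- divided differences with cleared denominators -/
noncomputable def Dd {R : Type*} [CommRing R] [DecidableEq R] (s : Finset R) (b : R) : R :=
  ∏ b' ∈ s.erase b, (b - b')
noncomputable def De {R : Type*} [CommRing R] [DecidableEq R] (s : Finset R) (b : R) : R :=
  ∏ b' ∈ s.erase b, Dd s b'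

theorem dd_field {R E : Type*} [CommRing R] [DecidableEq R] [Field E] (ρ : R →+* E)
    (hρ : Function.Injective ρ) (s : Finset R) (w : R → E) :
    ∑ b ∈ s, w b * ρ (De s b) =
      (∑ b ∈ s, w b / ∏ b' ∈ s.erase b, (ρ b - ρ b')) * ∏ b ∈ s, ρ (Dd s b) := by
  rw [Finset.sum_mul]
  refine Finset.sum_congr rfl fun b hb => ?_
  have h1 : ρ (Dd s b) = ∏ b' ∈ s.erase b, (ρ b - ρ b') := by simp [Dd, map_prod]
  have h2 : ρ (Dd s b) ≠ 0 := by
    rw [h1, Finset.prod_ne_zero_iff]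
    intro b' hb'
    exact sub_ne_zero.2 fun h => (Finset.ne_of_mem_erase hb') (hρ h).symm
  rw [← h1, ← Finset.mul_prod_erase s _ hb, De, map_prod]
  field_simp

theorem dd_poly {R O : Type*} [CommRing R] [DecidableEq R] [CommRing O] [IsDomain O] (ρ : R →+* O)
    (hρ : Function.Injective ρ) (s : Finset R) (n : ℕ) (hs : s.card = n + 1) (P : O[X])
    (hP : P.degree < n) : ∑ b ∈ s, P.eval (ρ b) * ρ (De s b) = 0 := by
  have hinj := IsFractionRing.injective O (FractionRing O)
  apply hinj
  have h := dd_field ((algebraMap O (FractionRing O)).comp ρ) (hinj.comp hρ) s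
    (fun b => algebraMap O (FractionRing O) (P.eval (ρ b)))
  rw [map_sum, map_zero]
  simp only [map_mul]
  simp only [RingHom.comp_apply] at h
  rw [h]
  have h2 := Lagrange.coeff_eq_sum (s := s) (v := fun b => algebraMap O (FractionRing O) (ρ b))
    (hinj.comp hρ).injOn (P := P.map (algebraMap O (FractionRing O))) (by
      refine lt_of_le_of_lt degree_map_le (hP.trans ?_)
      rw [hs]; exact_mod_cast Nat.lt_succ_self n)
  have h3 : (P.map (algebraMap O (FractionRing O))).coeff (s.card - 1) = 0 := by
    apply coeff_eq_zero_of_degree_lt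
    refine lt_of_le_of_lt degree_map_le ?_
    simpa [hs] using hP
  rw [h3] at h2
  simp only [eval_map_algebraMap, aeval_algebraMap_apply, coe_aeval_eq_eval] at h2
  rw [← h2, zero_mul]

end Hit

end

section
open Polynomial

namespace Hit

theorem natDegree_Dd_le {K : Type*} [Field K] [DecidableEq K[X]] (s : Finset K[X]) (e : ℕ)
    (he : ∀ b ∈ s, b.natDegree ≤ e) (b : K[X]) (hb : b ∈ s) :
    (Dd s b).natDegree ≤ (s.card - 1) * e := by
  unfold Dd
  refine (natDegree_prod_le _ _).trans ?_
  rw [← Finset.card_erase_of_mem hb, ← smul_eq_mul]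
  apply Finset.sum_le_card_nsmul
  intro x hx
  exact (natDegree_sub_le _ _).trans (max_le (he b hb) (he x (Finset.mem_of_mem_erase hx)))

theorem natDegree_De_le {K : Type*} [Field K] [DecidableEq K[X]] (s : Finset K[X]) (e : ℕ)
    (he : ∀ b ∈ s, b.natDegree ≤ e) (b : K[X]) (hb : b ∈ s) :
    (De s b).natDegree ≤ (s.card - 1) * ((s.card - 1) * e) := by
  unfold De
  refine (natDegree_prod_le _ _).trans ?_
  nth_rw 1 [← Finset.card_erase_of_mem hb]
  rw [← smul_eq_mul]
  apply Finset.sum_le_card_nsmul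
  intro x hx
  exact natDegree_Dd_le s e he x (Finset.mem_of_mem_erase hx)

theorem interp {K A Λ E : Type*} [Field K] [CommRing A] [IsDomain A] [Field Λ] [Field E]
    [DecidableEq K[X]]
    [Algebra A[X] E] [IsFractionRing A[X] E] (i : K →+* A) (j : A →+* Λ)
    (hj : Function.Injective j) (α : Λ) (S : Finset K[X]) (W : K[X] → A[X]) (Φ : Λ[X][X])
    (v : Λ[X]) (M n e D : ℕ) (he : ∀ b ∈ S, b.natDegree ≤ e) (hv : (X - C α) ^ M ∣ v)
    (hW : ∀ b ∈ S, (X - C α) ^ (M * n) ∣ (W b).map j - Φ.eval (v * (b.map i).map j))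
    (hD : ∀ b ∈ S, (W b).natDegree ≤ D) (hbig : D + n * (n * e) < M * n) :
    ∃ q : E[X], q.degree < n ∧
      ∀ b ∈ S, q.eval (algebraMap A[X] E (b.map i)) = algebraMap A[X] E (W b) := by
  have hi : Function.Injective i := i.injective
  have claim : ∀ s ⊆ S, s.card = n + 1 → ∑ b ∈ s, W b * (De s b).map i = 0 := by
    intro s hs hcard
    apply Polynomial.map_injective j hj
    rw [Polynomial.map_zero, Polynomial.map_sum]
    set Φn := Φ %ₘ (X ^ n) with hΦn
    have hΦ : ∀ b ∈ S, (X - C α) ^ (M * n) ∣ (W b).map j - Φn.eval (v * (b.map i).map j) := by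
      intro b hb
      have h1 : Φ = Φn + X ^ n * (Φ /ₘ X ^ n) := (modByMonic_add_div Φ _).symm
      have h2 : (X - C α) ^ (M * n) ∣
          Φ.eval (v * (b.map i).map j) - Φn.eval (v * (b.map i).map j) := by
        nth_rw 1 [h1]
        rw [eval_add, add_sub_cancel_left, eval_mul, eval_pow, eval_X, mul_pow, pow_mul]
        exact ((pow_dvd_pow_of_dvd hv n).mul_right _).mul_right _
      have := dvd_add (hW b hb) h2
      convert this using 1; ring
    have hdeg : Φn.degree < n := by
      have := degree_modByMonic_lt Φ (monic_X_pow (R := Λ[X]) n)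
      rwa [degree_X_pow] at this
    let P : Λ[X][X] := Φn.comp (C v * X)
    have hP : P.degree < n := by
      rw [degree_lt_iff_coeff_zero] at hdeg ⊢
      intro m hm
      rw [comp_C_mul_X_coeff, hdeg m hm, zero_mul]
    have h0 := dd_poly ((mapRingHom j).comp (mapRingHom i))
      ((Polynomial.map_injective j hj).comp (Polynomial.map_injective i hi)) s n hcard P hP
    simp only [RingHom.comp_apply, coe_mapRingHom, P, eval_comp, eval_mul, eval_C, eval_X] at h0
    refine Polynomial.eq_zero_of_dvd_of_natDegree_lt (p := (X - C α) ^ (M * n)) ?_ ?_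
    · have : ∑ b ∈ s, ((W b) * (De s b).map i).map j
          = ∑ b ∈ s, ((W b).map j - Φn.eval (v * (b.map i).map j)) * ((De s b).map i).map j := by
        simp only [sub_mul, Finset.sum_sub_distrib, h0, sub_zero, Polynomial.map_mul]
      rw [this]
      exact Finset.dvd_sum fun b hb => (hΦ b (hs hb)).mul_right _
    · rw [natDegree_pow, natDegree_X_sub_C, mul_one]
      refine lt_of_le_of_lt (natDegree_sum_le_of_forall_le s _ (n := D + n * (n * e)) ?_) hbig
      intro b hb
      refine natDegree_map_le.trans (natDegree_mul_le.trans (add_le_add (hD b (hs hb)) ?_))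
      have := natDegree_De_le s e (fun b hb => he b (hs hb)) b hb
      rw [hcard, Nat.add_sub_cancel] at this
      exact natDegree_map_le.trans this
  have hρ : Function.Injective ((algebraMap A[X] E).comp (mapRingHom i)) :=
    (IsFractionRing.injective A[X] E).comp (Polynomial.map_injective i hi)
  set ρ := (algebraMap A[X] E).comp (mapRingHom i) with hρd
  have hρe : ∀ b, ρ b = algebraMap A[X] E (b.map i) := fun b => rfl
  simp only [← hρe]
  set w : K[X] → E := fun b => algebraMap A[X] E (W b) with hw
  rcases le_or_gt S.card n with hc | hc
  · refine ⟨Lagrange.interpolate S ρ w, ?_, ?_⟩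
    · exact (Lagrange.degree_interpolate_lt _ hρ.injOn).trans_le (by exact_mod_cast hc)
    · intro b hb; exact Lagrange.eval_interpolate_at_node _ hρ.injOn hb
  · obtain ⟨s, hs, hsc⟩ := Finset.exists_subset_card_eq hc.le
    refine ⟨Lagrange.interpolate s ρ w, ?_, ?_⟩
    · rw [← hsc]; exact Lagrange.degree_interpolate_lt _ hρ.injOn
    · intro b hb
      by_cases hbs : b ∈ s
      · exact Lagrange.eval_interpolate_at_node _ hρ.injOn hbs
      have hc' : (insert b s).card = n + 1 := by rw [Finset.card_insert_of_notMem hbs, hsc]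
      have hsub : insert b s ⊆ S := Finset.insert_subset hb hs
      set P := Lagrange.interpolate (insert b s) ρ w with hP
      have hPd : P.degree < (insert b s).card := Lagrange.degree_interpolate_lt _ hρ.injOn
      have hPe : ∀ b' ∈ insert b s, P.eval (ρ b') = w b' := fun b' hb' =>
        Lagrange.eval_interpolate_at_node _ hρ.injOn hb'
      have hcoeff : P.coeff n = 0 := by
        have h1 := Lagrange.coeff_eq_sum (s := insert b s) (v := ρ) hρ.injOn hPd
        rw [hc', Nat.add_sub_cancel] at h1
        have h2 := dd_field ρ hρ (insert b s) w
        have h3 : ∑ b' ∈ insert b s, w b' * ρ (De (insert b s) b') = 0 := by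
          have := congrArg (algebraMap A[X] E) (claim _ hsub hc')
          rw [map_sum, map_zero] at this
          rw [← this]
          refine Finset.sum_congr rfl fun b' _ => ?_
          rw [map_mul]; rfl
        have h4 : ∏ b' ∈ insert b s, ρ (Dd (insert b s) b') ≠ 0 := by
          rw [Finset.prod_ne_zero_iff]
          intro b' _
          rw [Dd, map_prod, Finset.prod_ne_zero_iff]
          intro b'' hb''
          rw [map_sub]
          exact sub_ne_zero.2 fun h => (Finset.ne_of_mem_erase hb'') (hρ h).symm
        rw [h3] at h2
        have h5 := (mul_eq_zero.1 h2.symm).resolve_right h4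
        rw [h1, ← h5]
        exact Finset.sum_congr rfl fun b' hb' => by rw [hPe b' hb']
      have hPn : P.degree < s.card := by
        rw [hsc, degree_lt_iff_coeff_zero]
        intro m hm
        rcases hm.eq_or_lt with rfl | hm
        · exact hcoeff
        · rw [hc', degree_lt_iff_coeff_zero] at hPd
          exact hPd m hm
      rw [← Lagrange.eq_interpolate_of_eval_eq w hρ.injOn hPn
        (fun b' hb' => hPe b' (Finset.mem_insert_of_mem hb'))]
      exact hPe b (Finset.mem_insert_self _ _)

end Hit

end

section
open Polynomial

namespace Hit

theorem exists_deg_bound {A : Type*} [Semiring A] (F : A[X][X]) :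
    ∃ κ, ∀ l, (F.coeff l).natDegree ≤ κ := by
  refine ⟨F.support.sup fun l => (F.coeff l).natDegree, fun l => ?_⟩
  by_cases h : l ∈ F.support
  · exact Finset.le_sup (f := fun l => (F.coeff l).natDegree) h
  · rw [notMem_support_iff.1 h]; simp

theorem exists_deg_bound2 {A : Type*} [Semiring A] (F : A[X][X][X]) :
    ∃ c, ∀ l m, ((F.coeff l).coeff m).natDegree ≤ c := by
  choose c hc using fun l => exists_deg_bound (F.coeff l)
  refine ⟨F.support.sup c, fun l m => ?_⟩
  by_cases h : l ∈ F.support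
  · exact (hc l m).trans (Finset.le_sup h)
  · rw [notMem_support_iff.1 h]; simp

theorem natDegree_eval_le' {A : Type*} [CommRing A] (p : A[X][X]) (a : A[X]) (κ c D : ℕ)
    (h1 : p.natDegree ≤ κ) (h2 : ∀ m, (p.coeff m).natDegree ≤ c) (h3 : a.natDegree ≤ D) :
    (p.eval a).natDegree ≤ c + κ * D := by
  rw [eval_eq_sum_range]
  apply natDegree_sum_le_of_forall_le
  intro m hm
  refine natDegree_mul_le.trans (add_le_add (h2 m) ?_)
  refine natDegree_pow_le.trans (Nat.mul_le_mul ?_ h3)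
  simp at hm; omega

theorem hit1 {K A Λ : Type*} [Field K] [CommRing A] [IsDomain A] [UniqueFactorizationMonoid A]
    [Field Λ] [IsAlgClosed Λ] (i : K →+* A) (j : A →+* Λ) (hj : Function.Injective j)
    (π : K[X]) (hπ : π ≠ 0) (α : Λ) (hα : ((π.map i).map j).eval α = 0) (F : A[X][X][X])
    (hF : F.Monic) (hirr : Irreducible F) (d : A[X][X]) (U V : A[X][X][X])
    (hUV : U * F + V * derivative F = C d) (u μ : A[X]) (hμ : μ ≠ 0)
    (hd : ((d.eval u).map j).eval α ≠ 0) :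
    ∃ B : ℕ, ∀ S : Finset K[X], ∃ M0, ∀ M ≥ M0, ∀ T ⊆ S,
      (∀ b ∈ T, ¬ Irreducible (F.map (evalRingHom (u + μ * (π ^ M * b).map i)))) →
      T.card ≤ B := by
  classical
  obtain ⟨κ, hκ⟩ := exists_deg_bound F
  obtain ⟨c0, hc0⟩ := exists_deg_bound2 F
  set N := F.natDegree with hN
  set g := π.natDegree with hg
  set n := κ * g + 1 with hn
  let φ : A[X][X] →+* Λ[X][X] := eval₂RingHom (C.comp (mapRingHom j)) (C (u.map j) + X)
  set f : Λ[X][X][X] := F.map φ with hf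
  set ε : Λ[X][X] →+* Λ := (evalRingHom α).comp (evalRingHom 0) with hε
  have hφd : ε (φ d) ≠ 0 := by
    have : ε.comp φ = ((evalRingHom α).comp (mapRingHom j)).comp (evalRingHom u) := by
      apply Polynomial.ringHom_ext
      · intro a; simp [ε, φ]
      · simp [ε, φ]
    have h2 : ε (φ d) = ((d.eval u).map j).eval α := congrArg (fun h : A[X][X] →+* Λ => h d) this
    rwa [h2]
  have sep : ∀ ζ, (f.map ε).eval ζ = 0 → (f.map ε).derivative.eval ζ ≠ 0 := by
    intro ζ h0 h1
    apply hφd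
    have h2 := congrArg (fun P : A[X][X][X] => eval ζ (P.map (ε.comp φ))) hUV
    simp only [Polynomial.map_add, Polynomial.map_mul, eval_add, eval_mul, map_C, eval_C,
      ← derivative_map, ← Polynomial.map_map] at h2
    rw [← hf, h0, h1] at h2
    simpa using h2.symm
  set R := (f.map ε).roots.toFinset with hR
  set B0 := max (2 * n) κ with hB0
  refine ⟨(2 ^ R.card * 2 ^ R.card) * B0, fun S => ?_⟩
  set e := S.sup natDegree with he
  set c1 := u.natDegree + μ.natDegree + e with hc1
  refine ⟨c0 + κ * c1 + n * (n * e) + 1, fun M hM T hTS hbad => ?_⟩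
  have heS : ∀ b ∈ S, b.natDegree ≤ e := fun b hb => Finset.le_sup (f := natDegree) hb
  set D := c0 + κ * (c1 + g * M) with hD
  have hbig : D + n * (n * e) < M * n := by
    rw [hD, hn, ← hn]
    have : M * n = κ * (g * M) + M := by rw [hn]; ring
    rw [this, mul_add]; omega
  set a : K[X] → A[X] := fun b => u + μ * (π ^ M * b).map i with ha
  set x : K[X] → Λ[X] := fun b => (μ * (π ^ M * b).map i).map j with hx
  set v : A[X] := μ * (π ^ M).map i with hv
  have hav : ∀ b, a b = u + v * b.map i := by
    intro b; simp only [ha, hv, Polynomial.map_mul]; ring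
  have hxv : ∀ b, x b = v.map j * (b.map i).map j := by
    intro b; simp only [hx, hv, Polynomial.map_mul]; ring
  have hM1 : M ≠ 0 := by omega
  have hvdvd : (X - C α) ^ M ∣ v.map j := by
    simp only [hv, Polynomial.map_mul, Polynomial.map_pow]
    exact (pow_dvd_pow_of_dvd (dvd_iff_isRoot.2 hα) M).mul_left _
  have hxα : ∀ b, (x b).eval α = 0 := by
    intro b
    have : (X - C α) ∣ x b := by
      rw [hxv]; exact ((dvd_pow_self _ hM1).trans hvdvd).mul_right _
    exact dvd_iff_isRoot.1 this
  have hv0 : v ≠ 0 := by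
    refine mul_ne_zero hμ ?_
    rw [Polynomial.map_ne_zero_iff i.injective]; exact pow_ne_zero _ hπ
  have hadeg : ∀ b ∈ S, (a b).natDegree ≤ c1 + g * M := by
    intro b hb
    refine (natDegree_add_le _ _).trans (max_le (by omega) ?_)
    refine natDegree_mul_le.trans ?_
    have h1 : ((π ^ M * b).map i).natDegree ≤ M * g + e :=
      natDegree_map_le.trans (natDegree_mul_le.trans (add_le_add natDegree_pow_le (heS b hb)))
    rw [mul_comm M g] at h1; omega
  have hfx : ∀ b, f.map (evalRingHom (x b)) = (F.map (evalRingHom (a b))).map (mapRingHom j) := by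
    intro b
    rw [hf, Polynomial.map_map, Polynomial.map_map]
    congr 1
    apply Polynomial.ringHom_ext
    · intro y; simp [φ]
    · simp [φ, ha, hx]
  -- choose factorizations
  have hfac : ∀ b, ∃ G H : A[X][X], b ∈ T → G.Monic ∧ H.Monic ∧
      G * H = F.map (evalRingHom (a b)) ∧ G.natDegree ≠ 0 ∧ H.natDegree ≠ 0 := by
    intro b
    by_cases hb : b ∈ T
    · have h := hbad b hb
      have hm := hF.map (evalRingHom (a b))
      rw [hm.irreducible_iff_natDegree] at h
      by_cases h1 : F.map (evalRingHom (a b)) = 1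
      · exfalso
        have h2 : F.natDegree = 0 := by
          rw [← hF.natDegree_map (evalRingHom (a b)), h1, natDegree_one]
        rw [hF.natDegree_eq_zero] at h2
        rw [h2] at hirr; exact not_irreducible_one hirr
      · push Not at h
        obtain ⟨G, H, hG, hH, h2, h3, h4⟩ := h h1
        exact ⟨G, H, fun _ => ⟨hG, hH, h2, h3, h4⟩⟩
    · exact ⟨0, 0, fun h => absurd h hb⟩
  choose G H hGH using hfac
  obtain ⟨z, hz⟩ := approx α f sep (M * n)
  by_contra hcard
  push Not at hcard
  let rt : A[X][X] → Finset Λ := fun G =>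
    ((G.map (mapRingHom j)).map (evalRingHom α)).roots.toFinset
  have hrt : ∀ b ∈ T, ∀ P : A[X][X], P.Monic → P ∣ F.map (evalRingHom (a b)) →
      rt P ∈ R.powerset := by
    intro b hb P hP hdvd
    rw [Finset.mem_powerset]
    intro ζ hζ
    have hfε : f.map ε = ((F.map (evalRingHom (a b))).map (mapRingHom j)).map (evalRingHom α) := by
      rw [← hfx, Polynomial.map_map (evalRingHom (x b))]
      refine congrArg (fun h => Polynomial.map h f) ?_
      apply Polynomial.ringHom_ext
      · intro y; simp [hε]
      · simp [hε, hxα]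
    have hne : f.map ε ≠ 0 := by
      rw [hfε]; exact (((hF.map _).map _).map _).ne_zero
    rw [Multiset.mem_toFinset, mem_roots (((hP.map _).map _).ne_zero)] at hζ
    rw [hR, Multiset.mem_toFinset, mem_roots hne, hfε]
    exact IsRoot.dvd hζ (Polynomial.map_dvd _ (Polynomial.map_dvd _ hdvd))
  obtain ⟨⟨I, I'⟩, -, hfib⟩ := Finset.exists_lt_card_fiber_of_mul_lt_card_of_maps_to
    (s := T) (t := R.powerset ×ˢ R.powerset) (f := fun b => (rt (G b), rt (H b))) (n := B0)
    (by
      intro b hb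
      obtain ⟨h1, h2, h3, -, -⟩ := hGH b hb
      exact Finset.mem_product.2 ⟨hrt b hb _ h1 (h3 ▸ dvd_mul_right _ _),
        hrt b hb _ h2 (h3 ▸ dvd_mul_left _ _)⟩)
    (by rw [Finset.card_product, Finset.card_powerset]; exact hcard)
  set T' := {b ∈ T | (rt (G b), rt (H b)) = (I, I')} with hT'
  have hT'T : ∀ b ∈ T', b ∈ T := fun b hb => (Finset.mem_filter.1 hb).1
  have hT'I : ∀ b ∈ T', rt (G b) = I := fun b hb => congrArg Prod.fst (Finset.mem_filter.1 hb).2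
  have hTIeq : ∀ b ∈ T', rt (H b) = I' := fun b hb => congrArg Prod.snd (Finset.mem_filter.1 hb).2
  let E := FractionRing A[X]
  have hintg : ∀ (P Q : K[X] → A[X][X]) (I : Finset Λ), (∀ b ∈ T', (P b).Monic ∧ (Q b).Monic ∧
      P b * Q b = F.map (evalRingHom (a b)) ∧ rt (P b) = I) → ∀ l, ∃ q : E[X], q.degree < n ∧
      ∀ b ∈ T', q.eval (algebraMap A[X] E (b.map i)) = algebraMap A[X] E ((P b).coeff l) := by
    intro P Q I h l
    refine interp i j hj α T' (fun b => (P b).coeff l) ((∏ ζ ∈ I, (X - C (z ζ))).coeff l)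
      (v.map j) M n e D (fun b hb => heS b (hTS (hT'T b hb))) hvdvd ?_ ?_ hbig
    · intro b hb
      obtain ⟨h1, h2, h3, h4⟩ := h b hb
      have := hz (x b) (hxα b) ((P b).map (mapRingHom j)) ((Q b).map (mapRingHom j)) (h1.map _)
        (h2.map _) (by rw [← Polynomial.map_mul, h3, hfx]) l
      rw [← hxv, ← h4]
      simpa using this
    · intro b hb
      obtain ⟨h1, h2, h3, h4⟩ := h b hb
      refine coeff_degree_le (P b) (Q b) h1.ne_zero h2.ne_zero D ?_ l
      intro l
      rw [h3, coeff_map]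
      exact natDegree_eval_le' _ _ κ c0 _ (hκ l) (hc0 l) (hadeg b (hTS (hT'T b hb)))
  choose q hq1 hq2 using hintg G H I (fun b hb => by
    obtain ⟨h1, h2, h3, -, -⟩ := hGH b (hT'T b hb)
    exact ⟨h1, h2, h3, hT'I b hb⟩)
  choose r hr1 hr2 using hintg H G I' (fun b hb => by
    obtain ⟨h1, h2, h3, -, -⟩ := hGH b (hT'T b hb)
    exact ⟨h2, h1, by rw [mul_comm, h3], hTIeq b hb⟩)
  set ρ : K[X] → E := fun b => algebraMap A[X] E (b.map i) with hρ
  have hρi : Function.Injective ρ :=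
    (IsFractionRing.injective A[X] E).comp (Polynomial.map_injective i i.injective)
  let asm : (ℕ → E[X]) → E[X][X] := fun q => ∑ l ∈ Finset.range (N + 1), monomial l (q l)
  have hasm : ∀ (q : ℕ → E[X]) l, (asm q).coeff l = if l < N + 1 then q l else 0 := by
    intro q l
    simp [asm, coeff_monomial]
  have hasmdeg : ∀ (q : ℕ → E[X]), (∀ l, (q l).degree < n) → ∀ l,
      ((asm q).coeff l).natDegree ≤ n := by
    intro q hq l
    rw [hasm]
    split_ifs
    · exact natDegree_le_of_degree_le (hq l).le
    · simp
  have hasmev : ∀ (P : A[X][X]) (q : ℕ → E[X]) (b : K[X]), P.natDegree ≤ N →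
      (∀ l, (q l).eval (ρ b) = algebraMap A[X] E (P.coeff l)) →
      (asm q).map (evalRingHom (ρ b)) = P.map (algebraMap A[X] E) := by
    intro P q b hP hq
    ext l
    rw [coeff_map, hasm, coeff_map]
    split_ifs with h
    · exact hq l
    · rw [coeff_eq_zero_of_natDegree_lt (by omega)]; simp
  have hndeg : ∀ b ∈ T', (G b).natDegree ≤ N ∧ (H b).natDegree ≤ N := by
    intro b hb
    obtain ⟨h1, h2, h3, -, -⟩ := hGH b (hT'T b hb)
    have h4 : (G b * H b).natDegree = N := by
      rw [h3, hF.natDegree_map]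
    rw [h1.natDegree_mul h2] at h4
    omega
  set FY := F.map (eval₂RingHom (C.comp (algebraMap A[X] E))
      (C (algebraMap A[X] E u) + C (algebraMap A[X] E v) * X)) with hFY
  have hFYirr : Irreducible FY := irr_shift E F hF hirr u v hv0
  have hFYdeg : ∀ l, (FY.coeff l).natDegree ≤ κ := by
    intro l
    rw [hFY, coeff_map, coe_eval₂RingHom, ← eval₂_map, ← comp]
    refine natDegree_comp_le.trans ?_
    calc _ ≤ κ * 1 := Nat.mul_le_mul (natDegree_map_le.trans (hκ l)) (by compute_degree)
      _ = κ := mul_one _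
  have hFYev : ∀ b, FY.map (evalRingHom (ρ b)) =
      (F.map (evalRingHom (a b))).map (algebraMap A[X] E) := by
    intro b
    rw [hFY, Polynomial.map_map, Polynomial.map_map]
    congr 1
    apply Polynomial.ringHom_ext
    · intro y; simp
    · simp [hav, hρ]
  have hprod : asm q * asm r = FY := by
    ext1 l
    apply eq_of_natDegree_lt_card_of_eval_eq' _ _ (T'.image ρ)
    · intro y hy
      obtain ⟨b, hb, rfl⟩ := Finset.mem_image.1 hy
      obtain ⟨h1, h2, h3, -, -⟩ := hGH b (hT'T b hb)
      have : (asm q * asm r).map (evalRingHom (ρ b)) = FY.map (evalRingHom (ρ b)) := by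
        rw [Polynomial.map_mul, hasmev (G b) q b (hndeg b hb).1 (fun l => hq2 l b hb),
          hasmev (H b) r b (hndeg b hb).2 (fun l => hr2 l b hb), hFYev, ← h3, Polynomial.map_mul]
      have := congrArg (fun P => coeff P l) this
      simpa only [coeff_map, coe_evalRingHom] using this
    · rw [Finset.card_image_of_injective _ hρi]
      refine lt_of_le_of_lt (max_le_max ?_ (hFYdeg l)) hfib
      rw [coeff_mul]
      apply natDegree_sum_le_of_forall_le
      intro p _
      refine natDegree_mul_le.trans ?_
      have h1 := hasmdeg q hq1 p.1
      have h2 := hasmdeg r hr1 p.2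
      omega
  obtain ⟨b, hb⟩ : T'.Nonempty := Finset.card_pos.1 (by omega)
  obtain ⟨h1, h2, h3, h4, h5⟩ := hGH b (hT'T b hb)
  rcases hFYirr.isUnit_or_isUnit hprod.symm with h | h
  · have h6 := h.map (mapRingHom (evalRingHom (ρ b)))
    rw [coe_mapRingHom, hasmev (G b) q b (hndeg b hb).1 (fun l => hq2 l b hb)] at h6
    have := natDegree_eq_zero_of_isUnit h6
    rw [h1.natDegree_map] at this
    exact h4 this
  · have h6 := h.map (mapRingHom (evalRingHom (ρ b)))
    rw [coe_mapRingHom, hasmev (H b) r b (hndeg b hb).2 (fun l => hr2 l b hb)] at h6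
    have := natDegree_eq_zero_of_isUnit h6
    rw [h2.natDegree_map] at this
    exact h5 this

end Hit

end

section
open Polynomial

namespace Hit

/-- separability with an explicit nonzero discriminant -/
def SepB {B : Type*} [CommRing B] (F : B[X]) : Prop :=
  ∃ d : B, d ≠ 0 ∧ ∃ U V : B[X], U * F + V * derivative F = C d

theorem hit_step {K k A : Type*} [Field K] [Field k] [Infinite k] [Algebra K k]
    [Algebra.IsAlgebraic K k]
    [CommRing A] [IsDomain A] [UniqueFactorizationMonoid A] (i : k →+* A)
    (𝓕 : Finset A[X][X][X]) (δ : A[X][X]) (hδ : δ ≠ 0)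
    (h𝓕 : ∀ F ∈ 𝓕, F.Monic ∧ Irreducible F ∧ ∃ d, d ∣ δ ∧ ∃ U V : A[X][X][X],
      U * F + V * derivative F = C d) :
    ∃ a : K[X], X ∣ a ∧ (∀ F ∈ 𝓕, Irreducible
      (F.map (evalRingHom ((a.map (algebraMap K k)).map i)))) ∧
      δ.eval ((a.map (algebraMap K k)).map i) ≠ 0 := by
  classical
  let i' : K →+* A := i.comp (algebraMap K k)
  have hi' : ∀ a : K[X], (a.map (algebraMap K k)).map i = a.map i' := fun a => by
    rw [Polynomial.map_map]
  simp only [hi']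
  have hmapinj : Function.Injective (fun a : K[X] => a.map i') :=
    Polynomial.map_injective i' i'.injective
  -- choose τ
  obtain ⟨τ, hτ⟩ : ∃ τ : K[X], δ.eval (X * τ.map i') ≠ 0 := by
    by_contra! hcon
    apply hδ
    apply Polynomial.eq_zero_of_infinite_isRoot
    refine Set.Infinite.mono (s := Set.range fun τ : K[X] => X * τ.map i') ?_ ?_
    · rintro _ ⟨τ, rfl⟩; exact hcon τ
    · apply Set.infinite_range_of_injective
      intro a b hab
      exact hmapinj (mul_left_cancel₀ X_ne_zero hab)
  set u : A[X] := X * τ.map i' with hu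
  obtain ⟨α0, hα0⟩ : ∃ α0 : k, (δ.eval u).eval (i α0) ≠ 0 := by
    by_contra! hcon
    apply hτ
    apply Polynomial.eq_zero_of_infinite_isRoot
    refine Set.Infinite.mono (s := Set.range i) ?_ (Set.infinite_range_of_injective i.injective)
    rintro _ ⟨τ, rfl⟩; exact hcon τ
  let Λ := AlgebraicClosure (FractionRing A)
  let j : A →+* Λ := (algebraMap (FractionRing A) Λ).comp (algebraMap A (FractionRing A))
  have hj : Function.Injective j :=
    (algebraMap (FractionRing A) Λ).injective.comp (IsFractionRing.injective A _)
  set π := minpoly K α0 with hπd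
  have hintg : IsIntegral K α0 := Algebra.IsIntegral.isIntegral α0
  have hπ : π ≠ 0 := minpoly.ne_zero hintg
  have hπα : ((π.map i').map j).eval (j (i α0)) = 0 := by
    rw [Polynomial.map_map, eval_map, ← RingHom.comp_assoc, ← RingHom.comp_apply,
      ← hom_eval₂]
    have : eval₂ (algebraMap K k) α0 π = 0 := minpoly.aeval K α0
    rw [this, map_zero]
  have hB : ∀ F ∈ 𝓕, ∃ B : ℕ, ∀ S : Finset K[X], ∃ M0, ∀ M ≥ M0, ∀ T ⊆ S,
      (∀ b ∈ T, ¬ Irreducible (F.map (evalRingHom (u + X * (π ^ M * b).map i')))) →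
      T.card ≤ B := by
    intro F hF
    obtain ⟨h1, h2, d, hd, U, V, hUV⟩ := h𝓕 F hF
    refine hit1 i' j hj π hπ (j (i α0)) hπα F h1 h2 d U V hUV u X X_ne_zero ?_
    rw [eval_map, eval₂_hom]
    intro h0
    apply hα0
    have h3 : (d.eval u).eval (i α0) = 0 := hj (by rw [h0, map_zero])
    obtain ⟨c, hc⟩ := hd
    rw [hc, eval_mul, eval_mul, h3, zero_mul]
  choose! B hB using hB
  let n := ∑ F ∈ 𝓕, B F + δ.natDegree + 1
  let S : Finset K[X] := (Finset.range n).image fun l => X ^ l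
  have hS : S.card = n := by
    rw [Finset.card_image_of_injective, Finset.card_range]
    intro a b hab
    have := congrArg natDegree hab
    simpa using this
  choose! M0 hM0 using fun F hF => hB F hF S
  let M := 𝓕.sup M0
  let T : A[X][X][X] → Finset K[X] := fun F => S.filter fun b =>
    ¬ Irreducible (F.map (evalRingHom (u + X * (π ^ M * b).map i')))
  let T0 : Finset K[X] := S.filter fun b => δ.eval (u + X * (π ^ M * b).map i') = 0
  have hT : ∀ F ∈ 𝓕, (T F).card ≤ B F := fun F hF =>
    hM0 F hF M (Finset.le_sup hF) (T F) (Finset.filter_subset _ _)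
      fun b hb => (Finset.mem_filter.1 hb).2
  have hT0 : T0.card ≤ δ.natDegree := by
    have hinj : Function.Injective fun b : K[X] => u + X * (π ^ M * b).map i' := by
      intro a b hab
      have h1 := mul_left_cancel₀ X_ne_zero (add_left_cancel hab)
      exact mul_left_cancel₀ (pow_ne_zero M hπ) (hmapinj h1)
    rw [← Finset.card_image_of_injective T0 hinj]
    refine le_trans ?_ ((Multiset.toFinset_card_le δ.roots).trans (card_roots' δ))
    apply Finset.card_le_card
    intro y hy
    obtain ⟨b, hb, rfl⟩ := Finset.mem_image.1 hy
    rw [Multiset.mem_toFinset, mem_roots hδ]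
    exact (Finset.mem_filter.1 hb).2
  have hcard : (𝓕.biUnion T ∪ T0).card < S.card := by
    refine lt_of_le_of_lt (Finset.card_union_le _ _) ?_
    have h1 : (𝓕.biUnion T).card ≤ ∑ F ∈ 𝓕, B F :=
      Finset.card_biUnion_le.trans (Finset.sum_le_sum hT)
    rw [hS]; omega
  obtain ⟨b, hbS, hb⟩ := Finset.exists_mem_notMem_of_card_lt_card hcard
  have hab : (X * (τ + π ^ M * b)).map i' = u + X * (π ^ M * b).map i' := by
    rw [hu, Polynomial.map_mul, Polynomial.map_add, map_X, mul_add]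
  refine ⟨X * (τ + π ^ M * b), dvd_mul_right _ _, ?_, ?_⟩
  · intro F hF
    rw [hab]
    by_contra h
    exact hb (Finset.mem_union_left _ (Finset.mem_biUnion.2 ⟨F, hF, Finset.mem_filter.2 ⟨hbS, h⟩⟩))
  · rw [hab]
    intro h
    exact hb (Finset.mem_union_right _ (Finset.mem_filter.2 ⟨hbS, h⟩))

noncomputable def e2 (σ k : Type*) [Field k] :
    MvPolynomial σ k[X] ≃+* (MvPolynomial σ k)[X] :=
  RingEquiv.ofRingHom
    (MvPolynomial.eval₂Hom (mapRingHom MvPolynomial.C) (fun j => C (MvPolynomial.X j)) :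
      MvPolynomial σ k[X] →+* (MvPolynomial σ k)[X])
    (eval₂RingHom (MvPolynomial.map C) (MvPolynomial.C X) :
      (MvPolynomial σ k)[X] →+* MvPolynomial σ k[X])
    (by
      apply Polynomial.ringHom_ext
      · intro a
        simp only [RingHom.comp_apply, coe_eval₂RingHom, eval₂_C, RingHom.id_apply]
        have : (MvPolynomial.eval₂Hom (mapRingHom MvPolynomial.C) (fun j => C (MvPolynomial.X j)) :
            MvPolynomial σ k[X] →+* (MvPolynomial σ k)[X]).comp (MvPolynomial.map C) = C := by
          apply MvPolynomial.ringHom_ext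
          · intro a; simp
          · intro j; simp
        exact congrArg (fun h : MvPolynomial σ k →+* (MvPolynomial σ k)[X] => h a) this
      · simp)
    (by
      apply MvPolynomial.ringHom_ext
      · intro a
        simp only [RingHom.comp_apply, MvPolynomial.eval₂Hom_C, RingHom.id_apply]
        change ((eval₂RingHom _ _ : _ →+* _).comp (mapRingHom _)) a = _
        have : ((eval₂RingHom (MvPolynomial.map C) (MvPolynomial.C X) :
            (MvPolynomial σ k)[X] →+* MvPolynomial σ k[X]).comp (mapRingHom MvPolynomial.C))
            = MvPolynomial.C := by
          apply Polynomial.ringHom_ext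
          · intro a; simp
          · simp
        rw [this]
      · intro j; simp)

theorem e2_C (σ k : Type*) [Field k] (a : k[X]) :
    e2 σ k (MvPolynomial.C a) = a.map MvPolynomial.C := by
  simp [e2]

theorem irr_map_equiv {R S : Type*} [CommRing R] [CommRing S] (e : R ≃+* S) (F : R[X]) :
    Irreducible (F.map (e : R →+* S)) ↔ Irreducible F :=
  MulEquiv.irreducible_iff (Polynomial.mapEquiv e) (x := F)

theorem irr_map_bij {R S : Type*} [CommRing R] [CommRing S] (f : R →+* S)
    (hf : Function.Bijective f) (F : R[X]) : Irreducible (F.map f) ↔ Irreducible F :=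
  irr_map_equiv (RingEquiv.ofBijective f hf) F

theorem exists_Psi (k : Type*) [Field k] (m : ℕ) :
    ∃ Ψ : MvPolynomial (Fin (m+1)) k[X] →+* (MvPolynomial (Fin m) k)[X][X],
      Function.Bijective Ψ ∧ ∀ p (a : k[X]), e2 (Fin m) k (eval (MvPolynomial.C a)
        (MvPolynomial.finSuccEquiv k[X] m p)) = (Ψ p).eval (a.map MvPolynomial.C) := by
  refine ⟨((Polynomial.mapEquiv (e2 (Fin m) k)) : _ →+* _).comp
    (MvPolynomial.finSuccEquiv k[X] m :
      MvPolynomial (Fin (m+1)) k[X] →+* (MvPolynomial (Fin m) k[X])[X]), ?_, ?_⟩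
  · exact (Polynomial.mapEquiv (e2 (Fin m) k)).bijective.comp
      (MvPolynomial.finSuccEquiv k[X] m).bijective
  · intro p a
    rw [← e2_C]
    exact (eval_map_apply (e2 (Fin m) k :
      MvPolynomial (Fin m) k[X] →+* (MvPolynomial (Fin m) k)[X]) _).symm

theorem hitm {K k : Type*} [Field K] [Field k] [Infinite k] [Algebra K k]
    [Algebra.IsAlgebraic K k] (m : ℕ) :
    ∀ (𝓕 : Finset (MvPolynomial (Fin m) k[X])[X]),
    (∀ F ∈ 𝓕, F.Monic ∧ Irreducible F ∧ SepB F) → ∀ (δ : MvPolynomial (Fin m) k[X]), δ ≠ 0 →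
    ∃ a : Fin m → K[X], (∀ j, X ∣ a j) ∧
      (∀ F ∈ 𝓕, Irreducible (F.map (MvPolynomial.eval fun j => (a j).map (algebraMap K k)))) ∧
      MvPolynomial.eval (fun j => (a j).map (algebraMap K k)) δ ≠ 0 := by
  classical
  induction m with
  | zero =>
    intro 𝓕 h δ hδ
    refine ⟨fun j => 0, fun j => dvd_zero _, ?_, ?_⟩
    all_goals
      set ev := MvPolynomial.eval (fun j : Fin 0 => (0 : K[X]).map (algebraMap K k))
      have he : ev = ((MvPolynomial.isEmptyRingEquiv k[X] (Fin 0) : _ ≃+* _) : _ →+* _) := by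
        apply MvPolynomial.ringHom_ext
        · intro a
          rw [MvPolynomial.eval_C]
          exact ((MvPolynomial.isEmptyRingEquiv k[X] (Fin 0)).apply_symm_apply a).symm
        · intro j; exact j.elim0
      rw [he]
    · intro F hF
      rw [irr_map_equiv]; exact (h F hF).2.1
    · intro h0; exact hδ ((MvPolynomial.isEmptyRingEquiv k[X] (Fin 0)).map_eq_zero_iff.1 h0)
  | succ m ih =>
    intro 𝓕 h δ hδ
    choose! d hd0 U V hUV using fun F hF => (h F hF).2.2
    obtain ⟨Ψ, hΨ, hΨe⟩ := exists_Psi k m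
    set Δ := δ * ∏ F ∈ 𝓕, d F with hΔ
    have hΔ0 : Δ ≠ 0 := mul_ne_zero hδ (Finset.prod_ne_zero_iff.2 hd0)
    obtain ⟨a0, ha0, hirr, hne⟩ := hit_step (K := K) (MvPolynomial.C : k →+* MvPolynomial (Fin m) k)
      (𝓕.image fun F => F.map Ψ) (Ψ Δ) ((map_ne_zero_iff Ψ hΨ.1).2 hΔ0) (by
        intro F' hF'
        obtain ⟨F, hF, rfl⟩ := Finset.mem_image.1 hF'
        refine ⟨(h F hF).1.map _, ?_, Ψ (d F), ?_,
          (U F).map Ψ, (V F).map Ψ, ?_⟩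
        · exact (irr_map_bij (R := MvPolynomial (Fin (m+1)) k[X])
            (S := (MvPolynomial (Fin m) k)[X][X]) Ψ hΨ F).2 (h F hF).2.1
        · exact map_dvd Ψ ((Finset.dvd_prod_of_mem d hF).mul_left _)
        · rw [derivative_map, ← Polynomial.map_mul, ← Polynomial.map_mul, ← Polynomial.map_add,
            hUV F hF, map_C])
    set y0 : MvPolynomial (Fin m) k[X] := MvPolynomial.C (a0.map (algebraMap K k)) with hy0
    let spec : MvPolynomial (Fin (m+1)) k[X] →+* MvPolynomial (Fin m) k[X] :=
      (evalRingHom y0).comp (MvPolynomial.finSuccEquiv k[X] m : _ →+* _)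
    have hspec : ∀ p, e2 (Fin m) k (spec p) =
        (Ψ p).eval ((a0.map (algebraMap K k)).map MvPolynomial.C) := by
      intro p
      exact hΨe p _
    obtain ⟨a, ha, hirr', hne'⟩ := ih (𝓕.image fun F => F.map spec) (by
      intro F' hF'
      obtain ⟨F, hF, rfl⟩ := Finset.mem_image.1 hF'
      refine ⟨(h F hF).1.map _, ?_, spec (d F), ?_, (U F).map spec, (V F).map spec, ?_⟩
      · rw [← irr_map_equiv (e2 (Fin m) k), Polynomial.map_map]
        have := hirr _ (Finset.mem_image_of_mem _ hF)
        rw [Polynomial.map_map] at this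
        convert this using 2
        exact RingHom.ext hspec
      · intro h0
        apply hne
        have : d F ∣ Δ := (Finset.dvd_prod_of_mem d hF).mul_left _
        obtain ⟨c, hc⟩ := this
        rw [← hspec, hc, map_mul, h0, zero_mul, map_zero]
      · rw [derivative_map, ← Polynomial.map_mul, ← Polynomial.map_mul, ← Polynomial.map_add,
            hUV F hF, map_C]) (spec Δ) (by
        intro h0; apply hne; rw [← hspec, h0, map_zero])
    have hev : MvPolynomial.eval (fun j => ((Fin.cons a0 a : Fin (m+1) → K[X]) j).map
        (algebraMap K k)) =
        (MvPolynomial.eval fun j => (a j).map (algebraMap K k)).comp spec := by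
      apply MvPolynomial.ringHom_ext
      · intro p; simp [spec, MvPolynomial.finSuccEquiv_apply]
      · intro j
        refine Fin.cases ?_ (fun j => ?_) j
        · simp [spec, hy0, MvPolynomial.finSuccEquiv_X_zero]
        · simp [spec, MvPolynomial.finSuccEquiv_X_succ]
    refine ⟨Fin.cons a0 a, ?_, ?_, ?_⟩
    · intro j
      refine Fin.cases ?_ (fun j => ?_) j
      · exact ha0
      · exact ha j
    · intro F hF
      rw [hev, ← Polynomial.map_map]
      exact hirr' _ (Finset.mem_image_of_mem _ hF)
    · rw [hev, RingHom.comp_apply]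
      intro h0
      apply hne'
      rw [hΔ, map_mul, map_mul, h0, zero_mul]

end Hit

end

section
open Polynomial
namespace Hit
set_option linter.style.haveILetI false

theorem sep_field (E L : Type*) [Field E] [Field L] [Algebra E L] [FiniteDimensional E L]
    (p : ℕ) [ExpChar E p] : ∃ z : L, IsSeparable E z ∧ ∃ n : ℕ, ∀ x : L, ∃ G : E[X],
      x ^ p ^ n = aeval z G := by
  have : Algebra.IsAlgebraic E L := inferInstance
  obtain ⟨α, hα⟩ := Field.exists_primitive_element E (separableClosure E L)
  have : ExpChar (separableClosure E L) p :=
    expChar_of_injective_ringHom (algebraMap E (separableClosure E L)).injective p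
  refine ⟨α, mem_separableClosure_iff.mp α.2,
    IsPurelyInseparable.exponent (separableClosure E L) L, fun x => ?_⟩
  obtain ⟨y, hy⟩ := IsPurelyInseparable.exponent_def' (separableClosure E L) p x
  have hy' : y ∈ IntermediateField.adjoin E {α} := by rw [hα]; trivial
  rw [← IntermediateField.mem_toSubalgebra,
    IntermediateField.adjoin_simple_toSubalgebra_of_isAlgebraic (Algebra.IsAlgebraic.isAlgebraic α),
    Algebra.adjoin_singleton_eq_range_aeval] at hy'
  obtain ⟨G, rfl⟩ := hy'
  refine ⟨G, ?_⟩
  rw [← hy]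
  exact (aeval_algebraMap_apply L α G).symm

theorem lemZ (P R : Type*) [CommRing P] [IsDomain P] [CommRing R] [IsDomain R]
    [IsIntegrallyClosed P] [Algebra P R] [Module.Finite P R]
    (hinj : Function.Injective (algebraMap P R)) (p : ℕ) [ExpChar P p] :
    ∃ z : R, ∃ δ : P, δ ≠ 0 ∧ SepB (minpoly P z) ∧ ∃ n : ℕ, ∀ r : R, ∃ G : P[X],
      algebraMap P R δ * r ^ p ^ n = aeval z G := by
  classical
  have : FaithfulSMul P R := (faithfulSMul_iff_algebraMap_injective P R).mpr hinj
  letI : Algebra (FractionRing P) (FractionRing R) := FractionRing.liftAlgebra P (FractionRing R)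
  have : IsScalarTower P (FractionRing P) (FractionRing R) :=
    FractionRing.isScalarTower_liftAlgebra P (FractionRing R)
  set E := FractionRing P
  set L := FractionRing R
  have hdvd : ∀ b : R, b ≠ 0 → ∃ d : P, d ≠ 0 ∧ b ∣ algebraMap P R d := fun b hb =>
    (Algebra.IsAlgebraic.isAlgebraic (R := P) b).exists_nonzero_dvd (mem_nonZeroDivisors_of_ne_zero hb)
  have : IsLocalization (Algebra.algebraMapSubmonoid R (nonZeroDivisors P)) L := by
    refine (IsLocalization.iff_of_le_of_exists_dvd (S := L) _ (nonZeroDivisors R) ?_ ?_).mpr inferInstance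
    · rintro _ ⟨d, hd, rfl⟩
      exact mem_nonZeroDivisors_of_ne_zero
        (by simpa using (map_ne_zero_iff _ hinj).mpr (nonZeroDivisors.ne_zero hd))
    · intro b hb
      obtain ⟨d, hd, h⟩ := hdvd b (nonZeroDivisors.ne_zero hb)
      exact ⟨_, ⟨d, mem_nonZeroDivisors_of_ne_zero hd, rfl⟩, h⟩
  have : FiniteDimensional E L := .of_isLocalization P R (nonZeroDivisors P)
  have : ExpChar E p := expChar_of_injective_ringHom (IsFractionRing.injective P E) p
  have : ExpChar R p := expChar_of_injective_ringHom hinj p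
  have hRL : Function.Injective (algebraMap R L) := IsFractionRing.injective R L
  have hPE : Function.Injective (algebraMap P E) := IsFractionRing.injective P E
  obtain ⟨z0, hz0, n, hn⟩ := sep_field E L p
  -- scale `z0` into `R`
  obtain ⟨a, b, hb, rfl⟩ := IsFractionRing.div_surjective (A := R) z0
  obtain ⟨d, hd, b', hb'⟩ := hdvd b (nonZeroDivisors.ne_zero hb)
  set e : E := algebraMap P E d with he
  have he0 : e ≠ 0 := (map_ne_zero_iff _ hPE).mpr hd
  have hb0 : algebraMap R L b ≠ 0 := (map_ne_zero_iff _ hRL).mpr (nonZeroDivisors.ne_zero hb)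
  set z0 : L := algebraMap R L a / algebraMap R L b with hz0def
  have heL : algebraMap E L e = algebraMap R L b * algebraMap R L b' := by
    rw [he, ← IsScalarTower.algebraMap_apply P E L, IsScalarTower.algebraMap_apply P R L, hb', map_mul]
  have hz : algebraMap R L (a * b') = algebraMap E L e * z0 := by
    rw [heL, hz0def, map_mul, mul_div_assoc', eq_div_iff hb0]; ring
  set z : R := a * b' with hzdef
  have hzsep : IsSeparable E (algebraMap R L z) := by
    rw [hz, ← mem_separableClosure_iff]
    exact mul_mem ((separableClosure E L).algebraMap_mem e) (mem_separableClosure_iff.mpr hz0)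
  have hzint : IsIntegral P z := Algebra.IsIntegral.isIntegral z
  have hmin := minpoly.isIntegrallyClosed_eq_field_fractions E L hzint
  have key : ∀ r : R, ∃ δ : P, δ ≠ 0 ∧ ∃ G : P[X], algebraMap P R δ * r ^ p ^ n = aeval z G := by
    intro r
    obtain ⟨G, hG⟩ := hn (algebraMap R L r)
    set G' : E[X] := G.comp (C e⁻¹ * X) with hG'
    obtain ⟨δ, hδ, h⟩ := IsLocalization.integerNormalization_spec (nonZeroDivisors P) G'
    refine ⟨δ, nonZeroDivisors.ne_zero hδ,
      IsLocalization.integerNormalization (nonZeroDivisors P) G', hRL ?_⟩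
    rw [map_mul, map_pow, hG, ← aeval_algebraMap_apply L z, ← aeval_map_algebraMap E (R := P), h,
      ← algebraMap_smul E δ, map_smul, hG', aeval_comp, hz, Algebra.smul_def]
    congr 1
    · rw [← IsScalarTower.algebraMap_apply P R L, ← IsScalarTower.algebraMap_apply P E L]
    · have : aeval (algebraMap E L e * z0) (C e⁻¹ * X : E[X]) = z0 := by
        rw [map_mul, aeval_C, aeval_X, ← mul_assoc, ← map_mul, inv_mul_cancel₀ he0, map_one, one_mul]
      rw [this]
  choose δf hδf Gf hGf using key
  obtain ⟨s, hs⟩ := Module.Finite.fg_top (R := P) (M := R)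
  refine ⟨z, ∏ r ∈ s, δf r, Finset.prod_ne_zero_iff.mpr fun r _ => hδf r, ?_, n, ?_⟩
  · obtain ⟨U, V, hUV⟩ := hzsep
    rw [hmin, derivative_map] at hUV
    obtain ⟨b1, hb1, h1⟩ := IsLocalization.integerNormalization_spec (nonZeroDivisors P) U
    obtain ⟨b2, hb2, h2⟩ := IsLocalization.integerNormalization_spec (nonZeroDivisors P) V
    refine ⟨b1 * b2, mul_ne_zero (nonZeroDivisors.ne_zero hb1) (nonZeroDivisors.ne_zero hb2),
      C b2 * IsLocalization.integerNormalization (nonZeroDivisors P) U,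
      C b1 * IsLocalization.integerNormalization (nonZeroDivisors P) V, ?_⟩
    apply Polynomial.map_injective _ hPE
    simp only [Polynomial.map_add, Polynomial.map_mul, Polynomial.map_C, h1, h2]
    rw [← algebraMap_smul E b1, ← algebraMap_smul E b2]
    simp only [smul_eq_C_mul, map_mul]
    linear_combination (C (algebraMap P E b1) * C (algebraMap P E b2)) * hUV
  · intro r
    have hr : r ∈ Submodule.span P (s : Set R) := by rw [hs]; trivial
    have h1 : ∀ x ∈ s, ∃ G : P[X], algebraMap P R (∏ r ∈ s, δf r) * x ^ p ^ n = aeval z G := by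
      intro x hx
      refine ⟨C (∏ r ∈ s.erase x, δf r) * Gf x, ?_⟩
      rw [← Finset.mul_prod_erase s δf hx, map_mul, map_mul, aeval_C, ← hGf]; ring
    induction hr using Submodule.span_induction with
    | mem x hx => exact h1 x hx
    | zero => exact ⟨0, by simp [zero_pow (pow_ne_zero n (expChar_pos P p).ne')]⟩
    | add x y _ _ hx hy =>
      obtain ⟨G1, h1⟩ := hx
      obtain ⟨G2, h2⟩ := hy
      exact ⟨G1 + G2, by rw [add_pow_expChar_pow, mul_add, h1, h2, map_add]⟩
    | smul c x _ hx =>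
      obtain ⟨G1, h1⟩ := hx
      refine ⟨C (c ^ p ^ n) * G1, ?_⟩
      rw [map_mul, aeval_C, ← h1, Algebra.smul_def, mul_pow, map_pow]; ring
end Hit

end

section
open Polynomial
namespace Hit
set_option linter.style.haveILetI false

theorem sepB_of_dvd {B : Type*} [CommRing B] {F G : B[X]} (h : G ∣ F) (hF : SepB F) : SepB G := by
  obtain ⟨H, rfl⟩ := h
  obtain ⟨d, hd, U, V, h⟩ := hF
  refine ⟨d, hd, U * H + V * derivative H, V * H, ?_⟩
  rw [← h, derivative_mul]; ring

theorem ker_eval_le {σ A S : Type*} [CommRing A] [CommRing S] (a : σ → A)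
    (Θ : MvPolynomial σ A →+* S) (η : Ideal S)
    (h : ∀ j, Θ (MvPolynomial.X j - MvPolynomial.C (a j)) ∈ η) (b : MvPolynomial σ A) :
    Θ b - Θ (MvPolynomial.C (MvPolynomial.eval a b)) ∈ η := by
  have : (Ideal.Quotient.mk η).comp Θ =
      ((Ideal.Quotient.mk η).comp Θ).comp (MvPolynomial.C.comp (MvPolynomial.eval a)) := by
    refine MvPolynomial.ringHom_ext (fun r => by simp) (fun j => ?_)
    have := Ideal.Quotient.eq.mpr (by simpa using h j :
      Θ (MvPolynomial.X j) - Θ (MvPolynomial.C (a j)) ∈ η)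
    simpa using this
  exact Ideal.Quotient.eq.mp (RingHom.congr_fun this b)

theorem dvd_of_mem {B T : Type*} [CommRing B] [IsDomain B] [IsIntegrallyClosed B] [CommRing T]
    (f : B →+* T) (η : Ideal T) [η.IsPrime] (hinj : ∀ b, f b ∈ η → b = 0) (z : T)
    {F G : B[X]} (hm : F.Monic) (hirr : Irreducible F) (hF : eval₂ f z F ∈ η)
    (hG : eval₂ f z G ∈ η) : F ∣ G := by
  letI : Algebra B (T ⧸ η) := ((Ideal.Quotient.mk η).comp f).toAlgebra
  have hinj' : Function.Injective (algebraMap B (T ⧸ η)) := by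
    rw [injective_iff_map_eq_zero]
    intro b hb
    exact hinj b (Ideal.Quotient.eq_zero_iff_mem.mp hb)
  have : FaithfulSMul B (T ⧸ η) := (faithfulSMul_iff_algebraMap_injective B _).mpr hinj'
  have : Module.IsTorsionFree B (T ⧸ η) := inferInstance
  have key : ∀ G : B[X], eval₂ f z G ∈ η → aeval (Ideal.Quotient.mk η z) G = 0 := by
    intro G hG
    have := Ideal.Quotient.eq_zero_iff_mem.mpr hG
    rwa [hom_eval₂] at this
  have hintg : IsIntegral B (Ideal.Quotient.mk η z) := ⟨F, hm, key F hF⟩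
  have h1 := minpoly.isIntegrallyClosed_dvd hintg (key F hF)
  have h2 := minpoly.isIntegrallyClosed_dvd hintg (key G hG)
  exact ((minpoly.irreducible hintg).associated_of_dvd hirr h1).symm.dvd.trans h2

theorem exists_min {B T : Type*} [CommRing B] [IsDomain B] [CommRing T]
    (f : B →+* T) (hf : f.IsIntegral) (η : Ideal T) [η.IsPrime] (z : T) :
    ∃ F : B[X], F.Monic ∧ Irreducible F ∧ eval₂ f z F ∈ η := by
  letI : Algebra B (T ⧸ η) := ((Ideal.Quotient.mk η).comp f).toAlgebra
  have hintg : IsIntegral B (Ideal.Quotient.mk η z) := by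
    obtain ⟨F, hF, h⟩ := hf z
    refine ⟨F, hF, ?_⟩
    change eval₂ ((Ideal.Quotient.mk η).comp f) _ F = 0
    rw [← hom_eval₂, h, map_zero]
  refine ⟨minpoly B (Ideal.Quotient.mk η z), minpoly.monic hintg, minpoly.irreducible hintg, ?_⟩
  rw [← Ideal.Quotient.eq_zero_iff_mem, hom_eval₂]
  exact minpoly.aeval B _

theorem uniq_over {m : ℕ} {k T : Type*} [Field k] [CommRing T]
    (Θ : MvPolynomial (Fin m) k[X] →+* T) (a : Fin m → k[X]) (z : T)
    (F : (MvPolynomial (Fin m) k[X])[X]) (hm : F.Monic)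
    (hirr : Irreducible (F.map (MvPolynomial.eval a))) (w : Ideal T) (hFw : eval₂ Θ z F ∈ w)
    (δ : MvPolynomial (Fin m) k[X]) (hδ : MvPolynomial.eval a δ ≠ 0) (q : ℕ)
    (hq : ∀ s : T, ∃ G, Θ δ * s ^ q = eval₂ Θ z G)
    (η₁ η₂ : Ideal T) [η₁.IsPrime] [η₂.IsPrime] (hw₁ : w ≤ η₁) (hw₂ : w ≤ η₂)
    (h₁ : η₁.comap Θ = RingHom.ker (MvPolynomial.eval a))
    (h₂ : η₂.comap Θ = RingHom.ker (MvPolynomial.eval a)) (hq0 : q ≠ 0) : η₁ ≤ η₂ := by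
  intro s hs
  obtain ⟨G, hG⟩ := hq s
  have red : ∀ (η : Ideal T), η.comap Θ = RingHom.ker (MvPolynomial.eval a) →
      ∀ G : (MvPolynomial (Fin m) k[X])[X],
      Ideal.Quotient.mk η (eval₂ (Θ.comp MvPolynomial.C) z (G.map (MvPolynomial.eval a))) =
        Ideal.Quotient.mk η (eval₂ Θ z G) := by
    intro η hη G
    rw [hom_eval₂, hom_eval₂, eval₂_map]
    congr 1
    refine RingHom.ext fun b => ?_
    symm
    refine Ideal.Quotient.eq.mpr (ker_eval_le a Θ η (fun j => ?_) _)
    rw [← Ideal.mem_comap, hη, RingHom.mem_ker]; simp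
  have inj : ∀ b, (Θ.comp MvPolynomial.C) b ∈ η₁ → b = 0 := by
    intro b hb
    have : MvPolynomial.C b ∈ η₁.comap Θ := hb
    rw [h₁, RingHom.mem_ker] at this
    simpa using this
  have mem : ∀ (η : Ideal T), η.comap Θ = RingHom.ker (MvPolynomial.eval a) →
      ∀ G : (MvPolynomial (Fin m) k[X])[X],
      eval₂ (Θ.comp MvPolynomial.C) z (G.map (MvPolynomial.eval a)) ∈ η ↔ eval₂ Θ z G ∈ η := by
    intro η hη G
    rw [← Ideal.Quotient.eq_zero_iff_mem, red η hη, Ideal.Quotient.eq_zero_iff_mem]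
  have hGη : eval₂ Θ z G ∈ η₁ := by
    rw [← hG]; exact Ideal.mul_mem_left _ _ (Ideal.pow_mem_of_mem _ hs _ (Nat.pos_of_ne_zero hq0))
  have hdvd := dvd_of_mem (Θ.comp MvPolynomial.C) η₁ inj z (hm.map _) hirr
    ((mem η₁ h₁ F).mpr (hw₁ hFw)) ((mem η₁ h₁ G).mpr hGη)
  obtain ⟨H, hH⟩ := hdvd
  have h3 : eval₂ (Θ.comp MvPolynomial.C) z (G.map (MvPolynomial.eval a)) ∈ η₂ := by
    rw [hH, eval₂_mul]
    exact Ideal.mul_mem_right _ _ ((mem η₂ h₂ F).mpr (hw₂ hFw))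
  rw [mem η₂ h₂, ← hG] at h3
  rcases Ideal.IsPrime.mem_or_mem ‹η₂.IsPrime› h3 with h | h
  · exfalso
    apply hδ
    rw [← Ideal.mem_comap, h₂, RingHom.mem_ker] at h
    exact h
  · exact Ideal.IsPrime.mem_of_pow_mem ‹_› _ h

theorem map_integral (m : ℕ) (K k : Type*) [Field K] [Field k] [Algebra K k]
    [Algebra.IsAlgebraic K k] :
    (MvPolynomial.map (mapRingHom (algebraMap K k)) :
      MvPolynomial (Fin m) K[X] →+* MvPolynomial (Fin m) k[X]).IsIntegral := by
  set φ := (MvPolynomial.map (mapRingHom (algebraMap K k)) :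
      MvPolynomial (Fin m) K[X] →+* MvPolynomial (Fin m) k[X])
  have hX : φ.IsIntegralElem (MvPolynomial.C X) := by
    have := φ.isIntegralElem_map (x := MvPolynomial.C X)
    simpa [φ] using this
  have hc : ∀ c : k, φ.IsIntegralElem (MvPolynomial.C (C c)) := by
    intro c
    obtain ⟨f, hf, h⟩ := Algebra.IsIntegral.isIntegral (R := K) c
    refine ⟨f.map (MvPolynomial.C.comp C), hf.map _, ?_⟩
    rw [eval₂_map]
    have : φ.comp (MvPolynomial.C.comp C) = (MvPolynomial.C.comp C).comp (algebraMap K k) := by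
      ext x; simp [φ]
    rw [this]
    have h2 := hom_eval₂ f (algebraMap K k) (MvPolynomial.C.comp C :
      k →+* MvPolynomial (Fin m) k[X]) c
    rw [h, map_zero] at h2
    exact h2.symm
  have hC : ∀ g : k[X], φ.IsIntegralElem (MvPolynomial.C g) := by
    intro g
    induction g using Polynomial.induction_on' with
    | add p q hp hq => rw [map_add]; exact RingHom.IsIntegralElem.add φ hp hq
    | monomial n c =>
      rw [← C_mul_X_pow_eq_monomial, map_mul, map_pow]
      refine RingHom.IsIntegralElem.mul φ (hc c) ?_
      induction n with
      | zero => simpa using φ.isIntegralElem_one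
      | succ n ih => rw [pow_succ]; exact RingHom.IsIntegralElem.mul φ ih hX
  intro b
  induction b using MvPolynomial.induction_on with
  | C g => exact hC g
  | add p q hp hq => exact RingHom.IsIntegralElem.add φ hp hq
  | mul_X p j hp =>
    refine RingHom.IsIntegralElem.mul φ hp ?_
    have := φ.isIntegralElem_map (x := MvPolynomial.X j)
    simpa [φ] using this

theorem incomp {A B : Type*} [CommRing A] [CommRing B] (φ : A →+* B) (hφ : φ.IsIntegral)
    {I J : Ideal B} [I.IsPrime] (h : I ≤ J) (hc : I.comap φ = J.comap φ) : I = J := by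
  letI := φ.toAlgebra
  have : Algebra.IsIntegral A B := ⟨fun x => hφ x⟩
  by_contra hne
  exact (Ideal.IsIntegral.comap_lt_comap (R := A) (lt_of_le_of_ne h hne)).ne hc
end Hit

end

section
open Polynomial
namespace Hit
set_option linter.style.haveILetI false

theorem below {P R A k : Type*} [CommRing P] [IsDomain P] [IsIntegrallyClosed P] [CommRing R]
    [IsDomain R] [Algebra P R] [Module.Finite P R] (hinj : Function.Injective (algebraMap P R))
    [CommRing A] [IsDomain A] [Field k] (ev : P →+* A) (c : Ideal R)
    (hc : ∀ c' : Ideal R, c'.IsPrime → c'.comap (algebraMap P R) = RingHom.ker ev → c' = c)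
    (χ : R →+* k) (ε : A →+* k) (hχ : χ.comp (algebraMap P R) = ε.comp ev) :
    c ≤ RingHom.ker χ := by
  intro s hs
  have : FaithfulSMul P R := (faithfulSMul_iff_algebraMap_injective P R).mpr hinj
  set D := RingHom.ker ev with hD
  have hDp : D.IsPrime := RingHom.ker_isPrime ev
  obtain ⟨e, he, N, hy⟩ : ∃ e : P, e ∉ D ∧ ∃ N : ℕ,
      algebraMap P R e * s ^ N ∈ D.map (algebraMap P R) := by
    by_contra hcon
    push Not at hcon
    obtain ⟨c', hc', hDc', hdis⟩ := Ideal.exists_le_prime_disjoint (D.map (algebraMap P R))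
      (D.primeCompl.map (algebraMap P R) ⊔ Submonoid.powers s) (by
        rw [Set.disjoint_left]
        rintro y hy hy'
        obtain ⟨_, ⟨e, he, rfl⟩, _, ⟨N, rfl⟩, rfl⟩ := Submonoid.mem_sup.mp hy'
        exact hcon e he N hy)
    rw [Set.disjoint_left] at hdis
    have h1 : c'.comap (algebraMap P R) = D := by
      apply le_antisymm
      · intro e he
        by_contra hne
        exact hdis he (Submonoid.mem_sup_left ⟨e, hne, rfl⟩)
      · exact Ideal.map_le_iff_le_comap.mp hDc'
    rw [← hc c' hc' h1] at hs
    exact hdis hs (Submonoid.mem_sup_right (Submonoid.mem_powers s))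
  set y := algebraMap P R e * s ^ N with hydef
  obtain ⟨g, hgm, -, hgc, hg0⟩ :=
    LinearMap.exists_monic_and_natDegree_eq_and_coeff_mem_pow_and_aeval_eq_zero P
      (LinearMap.mulLeft P y) D (by
        rintro _ ⟨r, rfl⟩
        rw [Ideal.smul_top_eq_map]
        exact Ideal.mul_mem_right _ _ hy)
  have hgev : g.map ev = X ^ g.natDegree := by
    ext i
    rw [coeff_map, coeff_X_pow]
    split_ifs with h
    · rw [h, hgm.coeff_natDegree, map_one]
    · rcases lt_or_gt_of_ne h with h | h
      · have := Ideal.pow_le_self (Nat.sub_ne_zero_of_lt h) (hgc i)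
        exact this
      · rw [coeff_eq_zero_of_natDegree_lt h, map_zero]
  have hgy : aeval y g = 0 := by
    have h1 : aeval (LinearMap.mulLeft P y) g = LinearMap.mulLeft P (aeval y g) :=
      aeval_algHom_apply (Algebra.lmul P R) y g
    rw [h1] at hg0
    have := LinearMap.congr_fun hg0 1
    simpa using this
  set σ := s ^ N with hσ
  have hσint : IsIntegral P σ := Algebra.IsIntegral.isIntegral σ
  have hroot : aeval σ (g.comp (C e * X)) = 0 := by
    rw [aeval_comp]; simpa using hgy
  obtain ⟨u, hu⟩ := minpoly.isIntegrallyClosed_dvd hσint hroot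
  set f := minpoly P σ with hf
  have hfm : f.Monic := minpoly.monic hσint
  have hevE : Function.Injective (algebraMap A (FractionRing A)) := IsFractionRing.injective _ _
  obtain ⟨l, hl⟩ : ∃ l, f.map ev = X ^ l := by
    set ev' := (algebraMap A (FractionRing A)).comp ev
    have he' : ev' e ≠ 0 := by
      simp only [ev', RingHom.comp_apply]
      exact (map_ne_zero_iff _ hevE).mpr he
    have h1 : f.map ev' ∣ X ^ g.natDegree := by
      have h2 : (g.comp (C e * X)).map ev' = C (ev' e ^ g.natDegree) * X ^ g.natDegree := by
        rw [map_comp, ← Polynomial.map_map ev, hgev]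
        simp [mul_pow]
      have h3 : f.map ev' ∣ (g.comp (C e * X)).map ev' := ⟨u.map ev', by rw [hu, Polynomial.map_mul]⟩
      rw [h2] at h3
      exact (IsUnit.dvd_mul_left (isUnit_C.mpr (pow_ne_zero _ he').isUnit)).mp h3
    obtain ⟨l, -, hl⟩ := (dvd_prime_pow prime_X _).mp h1
    refine ⟨l, map_injective _ hevE ?_⟩
    rw [Polynomial.map_map, eq_of_monic_of_associated (hfm.map _) (monic_X_pow l) hl]
    simp
  have h0 : χ σ ^ l = 0 := by
    have h1 := congrArg χ (minpoly.aeval P σ)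
    rw [map_zero, aeval_def, hom_eval₂, hχ, ← eval₂_map, ← hf, hl, eval₂_X_pow] at h1
    exact h1
  have h2 := eq_zero_of_pow_eq_zero h0
  rw [hσ, map_pow] at h2
  exact eq_zero_of_pow_eq_zero h2

theorem core {K k : Type*} [Field K] [Field k] [Algebra K k] [Algebra.IsAlgebraic K k] [Infinite k]
    {m : ℕ} {R T ι : Type*} [CommRing R] [IsDomain R] [Algebra (MvPolynomial (Fin m) K[X]) R]
    [Module.Finite (MvPolynomial (Fin m) K[X]) R]
    (hinj : Function.Injective (algebraMap (MvPolynomial (Fin m) K[X]) R))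
    [CommRing T] [Algebra R T] [Algebra.IsIntegral R T] [IsNoetherianRing T]
    (hRT : Function.Injective (algebraMap R T))
    (Θ : MvPolynomial (Fin m) k[X] →+* T)
    (hΘ : Θ.comp (MvPolynomial.map (mapRingHom (algebraMap K k))) =
      (algebraMap R T).comp (algebraMap (MvPolynomial (Fin m) K[X]) R))
    (hgen : ∀ t : T, t ∈ AddSubgroup.closure {x | ∃ r b, x = algebraMap R T r * Θ b})
    (χ : ι → R →+* k)
    (hχ : ∀ i, (χ i).comp (algebraMap (MvPolynomial (Fin m) K[X]) R) =
      (algebraMap K k).comp ((evalRingHom 0).comp (MvPolynomial.eval 0)))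
    (h : R) (hh : h ≠ 0) :
    ∃ c : Ideal R, c.IsPrime ∧ h ∉ c ∧ (∀ i, c ≤ RingHom.ker (χ i)) ∧
      (∀ r : R, ∃ f : K[X][X], f.Monic ∧
        eval₂ ((algebraMap (MvPolynomial (Fin m) K[X]) R).comp MvPolynomial.C) r f ∈ c) ∧
      ∀ w : Ideal T, w.IsPrime → w.comap (algebraMap R T) = ⊥ →
        ∃! η : Ideal T, η.IsPrime ∧ w ≤ η ∧ η.comap (algebraMap R T) = c := by
  classical
  set P := MvPolynomial (Fin m) K[X] with hPdef
  set Pb := MvPolynomial (Fin m) k[X] with hPbdef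
  set φ : P →+* Pb := MvPolynomial.map (mapRingHom (algebraMap K k)) with hφdef
  have : FaithfulSMul P R := (faithfulSMul_iff_algebraMap_injective P R).mpr hinj
  have hφint : φ.IsIntegral := map_integral m K k
  have hφinj : Function.Injective φ :=
    MvPolynomial.map_injective _ (map_injective _ (algebraMap K k).injective)
  have hRTint : (algebraMap R T).IsIntegral := fun t => Algebra.IsIntegral.isIntegral (R := R) t
  have hPRint : (algebraMap P R).IsIntegral := fun t => Algebra.IsIntegral.isIntegral (R := P) t
  have hΘint : Θ.IsIntegral := by
    refine RingHom.IsIntegral.tower_top φ Θ ?_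
    rw [hΘ]; exact RingHom.IsIntegral.trans _ _ hPRint hRTint
  obtain ⟨p, hp⟩ := ExpChar.exists K
  have : ExpChar P p := expChar_of_injective_ringHom
    (f := (MvPolynomial.C.comp C : K →+* P)) (RingHom.injective _) p
  have : ExpChar Pb p := expChar_of_injective_ringHom hφinj p
  have : ExpChar R p := expChar_of_injective_ringHom hinj p
  have : ExpChar T p := expChar_of_injective_ringHom hRT p
  obtain ⟨z, δ, hδ, hsep, n, hz⟩ := lemZ P R hinj p
  set zT := algebraMap R T z with hzT
  have hzint : IsIntegral P z := Algebra.IsIntegral.isIntegral z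
  -- the generic elements
  have hq : ∀ s : T, ∃ G : Pb[X], Θ (φ δ) * s ^ p ^ n = eval₂ Θ zT G := by
    intro s
    induction hgen s using AddSubgroup.closure_induction with
    | mem x hx =>
      obtain ⟨r, b, rfl⟩ := hx
      obtain ⟨G, hG⟩ := hz r
      refine ⟨C (b ^ p ^ n) * G.map φ, ?_⟩
      rw [eval₂_mul, eval₂_C, eval₂_map, hΘ, ← hom_eval₂, ← aeval_def, ← hG, map_mul, map_pow,
        ← RingHom.comp_apply (algebraMap R T), ← hΘ, mul_pow, map_pow, RingHom.comp_apply]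
      ring
    | zero => exact ⟨0, by simp [zero_pow (pow_ne_zero n (expChar_pos P p).ne')]⟩
    | add x y _ _ hx hy =>
      obtain ⟨G1, h1⟩ := hx
      obtain ⟨G2, h2⟩ := hy
      exact ⟨G1 + G2, by rw [add_pow_expChar_pow, mul_add, h1, h2, eval₂_add]⟩
    | neg x _ hx =>
      obtain ⟨G1, h1⟩ := hx
      refine ⟨C ((-1) ^ p ^ n) * G1, ?_⟩
      rw [neg_pow, eval₂_mul, eval₂_C, map_pow, map_neg, map_one, ← h1]; ring
  -- the finitely many primes over zero
  set W : Set (Ideal T) := {w | w.IsPrime ∧ w.comap (algebraMap R T) = ⊥} with hW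
  have hWfin : W.Finite := by
    refine (minimalPrimes.finite_of_isNoetherianRing T).subset ?_
    rintro w ⟨hw, hw0⟩
    refine ⟨⟨hw, bot_le⟩, ?_⟩
    rintro w' ⟨hw', -⟩ hle
    have : w'.comap (algebraMap R T) = w.comap (algebraMap R T) := by
      rw [hw0, eq_bot_iff, ← hw0]; exact Ideal.comap_mono hle
    exact (incomp _ hRTint hle this).ge
  have hΘinj : ∀ w ∈ W, ∀ b, Θ b ∈ w → b = 0 := by
    rintro w ⟨hw, hw0⟩ b hb
    have h1 : (⊥ : Ideal Pb) = w.comap Θ := by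
      refine incomp φ hφint bot_le ?_
      rw [Ideal.comap_comap, hΘ, ← Ideal.comap_comap, hw0, ← RingHom.ker_eq_comap_bot,
        ← RingHom.ker_eq_comap_bot, (RingHom.injective_iff_ker_eq_bot _).mp hinj,
        (RingHom.injective_iff_ker_eq_bot _).mp hφinj]
    have h2 : b ∈ (⊥ : Ideal Pb) := by rw [h1]; exact hb
    exact h2
  have hF : ∀ w : Ideal T, ∃ F : Pb[X], w ∈ W → F.Monic ∧ Irreducible F ∧ eval₂ Θ zT F ∈ w := by
    intro w
    by_cases hw : w ∈ W
    · have := hw.1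
      obtain ⟨F, h⟩ := exists_min Θ hΘint w zT
      exact ⟨F, fun _ => h⟩
    · exact ⟨0, fun h => absurd h hw⟩
  choose F hF using hF
  obtain ⟨d, hd, hdh⟩ := (Algebra.IsAlgebraic.isAlgebraic (R := P) h).exists_nonzero_dvd
    (mem_nonZeroDivisors_of_ne_zero hh)
  obtain ⟨a, ha, hairr, haδ⟩ := hitm (K := K) (k := k) m (hWfin.toFinset.image F) (by
    intro G hG
    obtain ⟨w, hw, rfl⟩ := Finset.mem_image.mp hG
    have hw := hWfin.mem_toFinset.mp hw
    obtain ⟨h1, h2, h3⟩ := hF w hw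
    refine ⟨h1, h2, ?_⟩
    have := hw.1
    refine sepB_of_dvd (dvd_of_mem Θ w (hΘinj w hw) zT h1 h2 h3
      (G := (minpoly P z).map φ) ?_) ?_
    · rw [eval₂_map, hΘ, ← hom_eval₂, ← aeval_def, minpoly.aeval, map_zero]; exact w.zero_mem
    · obtain ⟨d, hd, U, V, hUV⟩ := hsep
      refine ⟨φ d, (map_ne_zero_iff _ hφinj).mpr hd, U.map φ, V.map φ, ?_⟩
      rw [derivative_map, ← Polynomial.map_mul, ← Polynomial.map_mul, ← Polynomial.map_add, hUV,
        Polynomial.map_C]) (φ (δ * d))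
      ((map_ne_zero_iff _ hφinj).mpr (mul_ne_zero hδ hd))
  set ab : Fin m → k[X] := fun j => (a j).map (algebraMap K k) with hab
  rw [map_mul, map_mul] at haδ
  have haδ1 := left_ne_zero_of_mul haδ
  have haδ2 := right_ne_zero_of_mul haδ
  set ev : P →+* K[X] := MvPolynomial.eval a with hev
  set evb : Pb →+* k[X] := MvPolynomial.eval ab with hevb
  have hevX : ∀ j, ev (MvPolynomial.X j) = a j := fun j => MvPolynomial.eval_X j
  have hevC : ∀ r, ev (MvPolynomial.C r) = r := fun r => MvPolynomial.eval_C r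
  have hevbX : ∀ j, evb (MvPolynomial.X j) = ab j := fun j => MvPolynomial.eval_X j
  have hevbC : ∀ r, evb (MvPolynomial.C r) = r := fun r => MvPolynomial.eval_C r
  have hφX : ∀ j, φ (MvPolynomial.X j) = MvPolynomial.X j := fun j => MvPolynomial.map_X _ j
  have hφC : ∀ r, φ (MvPolynomial.C r) = MvPolynomial.C (mapRingHom (algebraMap K k) r) :=
    fun r => MvPolynomial.map_C _ r
  have hcomm : evb.comp φ = (mapRingHom (algebraMap K k)).comp ev := by
    refine MvPolynomial.ringHom_ext (fun r => ?_) (fun j => ?_)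
    · rw [RingHom.comp_apply, RingHom.comp_apply, hφC, hevC, hevbC]
    · rw [RingHom.comp_apply, RingHom.comp_apply, hφX, hevX, hevbX]; rfl
  have hkmap : Function.Injective (mapRingHom (algebraMap K k)) :=
    map_injective _ (algebraMap K k).injective
  have hDcomap : (RingHom.ker evb).comap φ = RingHom.ker ev := by
    rw [RingHom.comap_ker, hcomm]
    ext x
    simp only [RingHom.mem_ker, RingHom.comp_apply]
    exact map_eq_zero_iff _ hkmap
  have hDbp : (RingHom.ker evb).IsPrime := RingHom.ker_isPrime evb
  -- primes over D_K lie over p_D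
  have hover : ∀ η : Ideal T, η.IsPrime →
      (η.comap (algebraMap R T)).comap (algebraMap P R) = RingHom.ker ev →
      η.comap Θ = RingHom.ker evb := by
    intro η hη h1
    rw [Ideal.comap_comap, ← hΘ, ← Ideal.comap_comap] at h1
    symm
    refine incomp φ hφint ?_ (by rw [h1, hDcomap])
    intro b hb
    have := ker_eval_le ab Θ η (fun j => ?_) b
    · rw [RingHom.mem_ker.mp hb] at this
      simpa using this
    · have h2 : (MvPolynomial.X j - MvPolynomial.C (a j) : P) ∈ (η.comap Θ).comap φ := by
        rw [h1, RingHom.mem_ker, map_sub, hevX, hevC, sub_self]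
      rw [Ideal.mem_comap, Ideal.mem_comap, map_sub, hφX, hφC] at h2
      exact h2
  have hback : ∀ η : Ideal T, η.comap Θ = RingHom.ker evb →
      (η.comap (algebraMap R T)).comap (algebraMap P R) = RingHom.ker ev := by
    intro η h1
    rw [Ideal.comap_comap, ← hΘ, ← Ideal.comap_comap, h1, hDcomap]
  have huniq : ∀ w ∈ W, ∀ η₁ η₂ : Ideal T, η₁.IsPrime → η₂.IsPrime → w ≤ η₁ → w ≤ η₂ →
      η₁.comap Θ = RingHom.ker evb → η₂.comap Θ = RingHom.ker evb → η₁ = η₂ := by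
    intro w hw η₁ η₂ hp1 hp2 hw1 hw2 h1 h2
    have hirr := hairr (F w) (Finset.mem_image_of_mem _ (hWfin.mem_toFinset.mpr hw))
    have hq0 : p ^ n ≠ 0 := pow_ne_zero n (expChar_pos P p).ne'
    exact le_antisymm
      (uniq_over Θ ab zT (F w) (hF w hw).1 hirr w (hF w hw).2.2 (φ δ) haδ1 _ hq η₁ η₂ hw1 hw2 h1 h2 hq0)
      (uniq_over Θ ab zT (F w) (hF w hw).1 hirr w (hF w hw).2.2 (φ δ) haδ1 _ hq η₂ η₁ hw2 hw1 h2 h1 hq0)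
  have hexist : ∀ w ∈ W, ∃ η : Ideal T, η.IsPrime ∧ w ≤ η ∧ η.comap Θ = RingHom.ker evb := by
    intro w hw
    letI := Θ.toAlgebra
    have : Algebra.IsIntegral Pb T := ⟨fun x => hΘint x⟩
    have h0 : w.comap (algebraMap Pb T) ≤ RingHom.ker evb := by
      intro b hb
      rw [hΘinj w hw b hb]; exact Ideal.zero_mem _
    obtain ⟨η, h1, h2, h3⟩ := Ideal.exists_ideal_over_prime_of_isIntegral (RingHom.ker evb) w h0
    exact ⟨η, h2, h1, h3⟩
  obtain ⟨w0, -, hw0p, hw0⟩ := Ideal.exists_ideal_over_prime_of_isIntegral (⊥ : Ideal R) (⊥ : Ideal T)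
    (by rw [← RingHom.ker_eq_comap_bot, (RingHom.injective_iff_ker_eq_bot _).mp hRT])
  have hw0W : w0 ∈ W := ⟨hw0p, hw0⟩
  obtain ⟨η0, hη0p, hη0w, hη0⟩ := hexist w0 hw0W
  have hall : ∀ c' : Ideal R, c'.IsPrime → c'.comap (algebraMap P R) = RingHom.ker ev →
      c' = η0.comap (algebraMap R T) := by
    intro c' hc' hc
    obtain ⟨η, h1, h2, h3⟩ := Ideal.exists_ideal_over_prime_of_isIntegral c' w0
      (by rw [hw0]; exact bot_le)
    rw [← h3, huniq w0 hw0W η η0 h2 hη0p h1 hη0w (hover η h2 (by rw [h3, hc])) hη0]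
  have hcP := hback η0 hη0
  refine ⟨η0.comap (algebraMap R T), inferInstance, ?_, ?_, ?_, ?_⟩
  · intro hmem
    have h1 : d ∈ (η0.comap (algebraMap R T)).comap (algebraMap P R) :=
      Ideal.mem_of_dvd (η0.comap (algebraMap R T)) hdh hmem
    rw [hcP, ← hDcomap] at h1
    exact haδ2 h1
  · intro i
    refine below hinj ev _ hall (χ i) ((algebraMap K k).comp (evalRingHom 0)) ?_
    rw [hχ i, RingHom.comp_assoc]
    congr 1
    refine MvPolynomial.ringHom_ext (fun r => ?_) (fun j => ?_)
    · simp [ev]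
    · obtain ⟨g, hg⟩ := ha j
      simp [ev, hg]
  · intro r
    obtain ⟨g, hg, hgr⟩ := hPRint r
    refine ⟨g.map ev, hg.map _, ?_⟩
    set c := η0.comap (algebraMap R T)
    rw [eval₂_map, ← Ideal.Quotient.eq_zero_iff_mem, hom_eval₂]
    have : (Ideal.Quotient.mk c).comp (((algebraMap P R).comp MvPolynomial.C).comp ev) =
        (Ideal.Quotient.mk c).comp (algebraMap P R) := by
      refine RingHom.ext fun b => ?_
      symm
      refine Ideal.Quotient.eq.mpr (ker_eval_le a (algebraMap P R) c (fun j => ?_) _)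
      rw [← Ideal.mem_comap, hcP, RingHom.mem_ker, map_sub, hevX, hevC, sub_self]
    rw [this, ← hom_eval₂, hgr, map_zero]
  · intro w hw hwb
    obtain ⟨η, h1, h2, h3⟩ := hexist w ⟨hw, hwb⟩
    refine ⟨η, ⟨h1, h2, hall _ inferInstance (hback η h3)⟩, ?_⟩
    rintro η' ⟨h1', h2', h3'⟩
    exact huniq w ⟨hw, hwb⟩ _ _ h1' h1 h2' h2 (hover η' h1' (by rw [h3', hcP])) h3
end Hit

end

section
open Polynomial
open scoped TensorProduct
namespace Hit
set_option linter.style.haveILetI false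

theorem noeth_tensor (K k R : Type*) [Field K] [Field k] [CommRing R] [Algebra K R] [Algebra K k]
    [Algebra.FiniteType K R] : IsNoetherianRing (R ⊗[K] k) := by
  have : Algebra.FiniteType k (k ⊗[K] R) := inferInstance
  have := Algebra.FiniteType.isNoetherianRing k (k ⊗[K] R)
  exact isNoetherianRing_of_ringEquiv _ (Algebra.TensorProduct.comm K k R).toRingEquiv

theorem norm' {K R : Type*} [Field K] [CommRing R] [IsDomain R]
    [Algebra K R] [Algebra.FiniteType K R] (htr : ¬ Algebra.IsAlgebraic K R)
    (ν : R → K[X]) (hν : ∀ r, (ν r).Monic) (hν1 : ∀ r, 0 < (ν r).natDegree) :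
    ∃ (m : ℕ) (x : Fin (m + 1) → R),
      Function.Injective (MvPolynomial.aeval (R := K) (fun j => aeval (x j) (ν (x j)))) ∧
      (MvPolynomial.aeval (R := K) (fun j => aeval (x j) (ν (x j)))).Finite := by
  obtain ⟨s, g, hgi, hgf⟩ := exists_finite_inj_algHom_of_fg K R
  obtain ⟨m, rfl⟩ : ∃ m, s = m + 1 := by
    rcases s with _ | m
    · exfalso
      apply htr
      have hintg : g.toRingHom.IsIntegral := hgf.to_isIntegral
      refine ⟨fun r => IsIntegral.isAlgebraic ?_⟩
      have h1 : (MvPolynomial.C : K →+* MvPolynomial (Fin 0) K).IsIntegral :=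
        RingHom.isIntegral_of_surjective _ (MvPolynomial.C_surjective (Fin 0))
      have h2 := RingHom.IsIntegral.trans _ _ h1 hintg r
      have h3 : g.toRingHom.comp MvPolynomial.C = algebraMap K R := g.comp_algebraMap
      rw [h3] at h2
      exact h2
    · exact ⟨m, rfl⟩
  set x := fun j => g (MvPolynomial.X j)
  refine ⟨m, x, ?_⟩
  set ψ : MvPolynomial (Fin (m+1)) K →ₐ[K] MvPolynomial (Fin (m+1)) K :=
    MvPolynomial.aeval (fun j => aeval (MvPolynomial.X j) (ν (x j))) with hψ
  have hcomp : MvPolynomial.aeval (R := K) (fun j => aeval (x j) (ν (x j))) = g.comp ψ := by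
    ext j
    simp [ψ, x, aeval_algHom_apply]
  have hψi : Function.Injective ψ := by
    have := (MvPolynomial.algebraicIndependent_X (Fin (m+1)) K).polynomial_aeval_of_transcendental
      (f := fun j => ν (x j)) (fun j => by
        exact Polynomial.transcendental _ (hν1 _).ne' (by rw [(hν _).leadingCoeff]; exact one_mem _))
    exact this
  have hψint : ψ.toRingHom.IsIntegral := by
    intro b
    induction b using MvPolynomial.induction_on with
    | C c => 
      have := ψ.toRingHom.isIntegralElem_map (x := MvPolynomial.C c)
      have h2 : ψ.toRingHom (MvPolynomial.C c) = MvPolynomial.C c := ψ.commutes c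
      rwa [h2] at this
    | add p q hp hq => exact RingHom.IsIntegralElem.add _ hp hq
    | mul_X p j hp =>
      refine RingHom.IsIntegralElem.mul _ hp ?_
      refine ⟨(ν (x j)).map MvPolynomial.C - C (MvPolynomial.X j), ?_, ?_⟩
      · apply (hν (x j)).map _ |>.sub_of_left
        rw [degree_map_eq_of_injective (MvPolynomial.C_injective _ _)]
        refine lt_of_le_of_lt degree_C_le ?_
        exact natDegree_pos_iff_degree_pos.mp (hν1 _)
      · rw [eval₂_sub, eval₂_C, eval₂_map]
        have h2 : ψ.toRingHom.comp MvPolynomial.C = algebraMap K _ := ψ.comp_algebraMap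
        rw [h2, ← aeval_def]
        simp [ψ]
  rw [hcomp]
  refine ⟨hgi.comp hψi, ?_⟩
  refine RingHom.finite_iff_isIntegral_and_finiteType.mpr ⟨?_, ?_⟩
  · exact RingHom.IsIntegral.trans _ _ hψint hgf.to_isIntegral
  · refine RingHom.FiniteType.of_comp_finiteType (f := algebraMap K _) ?_
    have : (g.comp ψ).toRingHom.comp (algebraMap K _) = algebraMap K R := (g.comp ψ).comp_algebraMap
    rw [this, RingHom.finiteType_algebraMap]; infer_instance

theorem partII {K k R : Type*} [Field K] [Field k] [Algebra K k] [Algebra.IsAlgebraic K k] [Infinite k]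
    [CommRing R] [IsDomain R] [Algebra K R] [Algebra.FiniteType K R]
    (htr : ¬ Algebra.IsAlgebraic K R) {ι : Type*} [Finite ι] (χ : ι → R →ₐ[K] k)
    (h : R) (hh : h ≠ 0) :
    ∃ c : Ideal R, c.IsPrime ∧ h ∉ c ∧ (∀ i, c ≤ RingHom.ker (χ i)) ∧
      (∃ t : R, ∀ r : R, ∃ f : K[X][X], f.Monic ∧
        eval₂ (aeval t : K[X] →ₐ[K] R).toRingHom r f ∈ c) ∧
      ∀ w : Ideal (R ⊗[K] k), w.IsPrime → w.comap (algebraMap R (R ⊗[K] k)) = ⊥ →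
        ∃! η : Ideal (R ⊗[K] k), η.IsPrime ∧ w ≤ η ∧ η.comap (algebraMap R (R ⊗[K] k)) = c := by
  have := Fintype.ofFinite ι
  have hki : ∀ i r, IsIntegral K (χ i r) := fun i r => Algebra.IsIntegral.isIntegral _
  obtain ⟨m, x, hinj, hfin⟩ := norm' (K := K) (R := R) htr
    (fun r => X * ∏ i, minpoly K (χ i r))
    (fun r => monic_X.mul (monic_prod_of_monic _ _ fun i _ => minpoly.monic (hki i r)))
    (fun r => by
      rw [natDegree_mul X_ne_zero (monic_prod_of_monic _ _ fun i _ => minpoly.monic (hki i r)).ne_zero,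
        natDegree_X]; omega)
  set y : Fin (m + 1) → R := fun j => aeval (x j) (X * ∏ i, minpoly K (χ i (x j))) with hy
  have hχy : ∀ i j, χ i (y j) = 0 := by
    intro i j
    simp only [hy]
    rw [← aeval_algHom_apply, map_mul, map_prod, Finset.prod_eq_zero (Finset.mem_univ i), mul_zero]
    exact minpoly.aeval K _
  set g : MvPolynomial (Fin (m+1)) K →ₐ[K] R := MvPolynomial.aeval y with hg
  set E : MvPolynomial (Fin (m + 1)) K ≃ₐ[K] MvPolynomial (Fin m) K[X] :=
    (MvPolynomial.renameEquiv K (finSuccEquiv m)).trans (MvPolynomial.optionEquivRight K (Fin m)) with hE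
  have hE0 : E.symm (MvPolynomial.C X) = MvPolynomial.X 0 := by
    rw [AlgEquiv.symm_apply_eq]; simp [E]
  have hEs : ∀ j, E.symm (MvPolynomial.X j) = MvPolynomial.X j.succ := by
    intro j
    rw [AlgEquiv.symm_apply_eq]; simp [E]
  letI : Algebra (MvPolynomial (Fin m) K[X]) R := (g.comp E.symm.toAlgHom).toRingHom.toAlgebra
  have hal : ∀ b, algebraMap (MvPolynomial (Fin m) K[X]) R b = g (E.symm b) := fun b => rfl
  have halC : ∀ c : K, algebraMap (MvPolynomial (Fin m) K[X]) R (MvPolynomial.C (C c)) =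
      algebraMap K R c := fun c => (g.comp E.symm.toAlgHom).commutes c
  have halX : algebraMap (MvPolynomial (Fin m) K[X]) R (MvPolynomial.C X) = y 0 := by
    rw [hal, hE0]; simp [g]
  have halj : ∀ j, algebraMap (MvPolynomial (Fin m) K[X]) R (MvPolynomial.X j) = y j.succ := by
    intro j
    rw [hal, hEs]; simp [g]
  have : Module.Finite (MvPolynomial (Fin m) K[X]) R := by
    have h1 : (g.toRingHom.comp E.symm.toRingEquiv.toRingHom).Finite :=
      RingHom.Finite.comp hfin (RingHom.Finite.of_surjective _ E.symm.surjective)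
    exact h1
  have hinj' : Function.Injective (algebraMap (MvPolynomial (Fin m) K[X]) R) :=
    hinj.comp E.symm.injective
  have := noeth_tensor K k R
  set Θ : MvPolynomial (Fin m) k[X] →+* R ⊗[K] k :=
    MvPolynomial.eval₂Hom (eval₂RingHom
      (Algebra.TensorProduct.includeRight : k →ₐ[K] R ⊗[K] k).toRingHom
      (algebraMap R (R ⊗[K] k) (y 0))) (fun j => algebraMap R (R ⊗[K] k) (y j.succ)) with hΘ
  have hΘC : ∀ c : k, Θ (MvPolynomial.C (C c)) = 1 ⊗ₜ c := by
    intro c; simp [Θ]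
  obtain ⟨c, h1, h2, h3, h4, h5⟩ := core (K := K) (k := k) hinj' (T := R ⊗[K] k)
    (FaithfulSMul.algebraMap_injective _ _) Θ (by
      refine MvPolynomial.ringHom_ext' ?_ ?_
      · refine Polynomial.ringHom_ext (fun c => ?_) ?_
        · simp only [RingHom.comp_apply, MvPolynomial.map_C, coe_mapRingHom, Polynomial.map_C, hΘC, halC]
          simp [Algebra.TensorProduct.algebraMap_apply, ← Algebra.TensorProduct.tmul_one_eq_one_tmul]
        · simp only [RingHom.comp_apply, MvPolynomial.map_C, coe_mapRingHom, Polynomial.map_X, halX]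
          simp [Θ]
      · intro j
        simp only [RingHom.comp_apply, MvPolynomial.map_X, halj]
        simp [Θ]) (by
      intro t
      induction t using TensorProduct.induction_on with
      | zero => exact zero_mem _
      | add a b ha hb => exact add_mem ha hb
      | tmul r c =>
        refine AddSubgroup.subset_closure ⟨r, MvPolynomial.C (C c), ?_⟩
        rw [hΘC, Algebra.TensorProduct.algebraMap_apply]; simp) (fun i => (χ i).toRingHom) (by
      intro i
      refine MvPolynomial.ringHom_ext' ?_ ?_
      · refine Polynomial.ringHom_ext (fun c => ?_) ?_
        · simp [halC]
        · simp [halX, hχy]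
      · intro j
        simp [halj, hχy]) h hh
  refine ⟨c, h1, h2, h3, ⟨y 0, fun r => ?_⟩, h5⟩
  obtain ⟨f, hf, hfr⟩ := h4 r
  refine ⟨f, hf, ?_⟩
  convert hfr using 2
  refine Polynomial.ringHom_ext (fun c => ?_) ?_
  · simp [halC]
  · simp [halX]
end Hit

end

section
open Polynomial
open scoped TensorProduct
namespace Hit
set_option linter.style.haveILetI false

theorem loc_exists {R M : Type*} [CommRing R] [CommRing M] (j : R →+* M)
    (hj : Function.Injective j) (τ : R) (hloc : ∀ f : M, ∃ (N : ℕ) (x : R), j x = j τ ^ N * f)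
    (c : Ideal R) [hc : c.IsPrime] (hτ : τ ∉ c) : ∃ d : Ideal M, d.IsPrime ∧ d.comap j = c := by
  have hcancel : ∀ N x, τ ^ N * x ∈ c → x ∈ c := fun N x h =>
    (hc.mem_or_mem h).resolve_left fun h => hτ (hc.mem_of_pow_mem _ h)
  let d : Ideal M :=
    { carrier := {f | ∃ (N : ℕ) (x : R), x ∈ c ∧ j x = j τ ^ N * f}
      add_mem' := by
        rintro f g ⟨N, x, hx, h1⟩ ⟨N', x', hx', h2⟩
        refine ⟨N + N', τ ^ N' * x + τ ^ N * x', c.add_mem (c.mul_mem_left _ hx) (c.mul_mem_left _ hx'), ?_⟩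
        simp only [map_add, map_mul, map_pow, h1, h2]; ring
      zero_mem' := ⟨0, 0, c.zero_mem, by simp⟩
      smul_mem' := by
        rintro g f ⟨N, x, hx, h1⟩
        obtain ⟨N', x', h2⟩ := hloc g
        refine ⟨N + N', x' * x, c.mul_mem_left _ hx, ?_⟩
        simp only [map_mul, h1, h2, smul_eq_mul]; ring }
  have hd : ∀ f, f ∈ d ↔ ∃ (N : ℕ) (x : R), x ∈ c ∧ j x = j τ ^ N * f := fun f => Iff.rfl
  have hcomap : d.comap j = c := by
    ext x
    rw [Ideal.mem_comap, hd]
    constructor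
    · rintro ⟨N, y, hy, h⟩
      rw [← map_pow, ← map_mul] at h
      rw [hj h] at hy
      exact hcancel _ _ hy
    · intro hx
      exact ⟨0, x, hx, by simp⟩
  refine ⟨d, ⟨?_, ?_⟩, hcomap⟩
  · intro h
    apply hc.ne_top
    rw [← hcomap, h, Ideal.comap_top]
  · intro f g hfg
    obtain ⟨N, x, hx, h⟩ := (hd _).mp hfg
    obtain ⟨N1, x1, h1⟩ := hloc f
    obtain ⟨N2, x2, h2⟩ := hloc g
    have : τ ^ N * (x1 * x2) = τ ^ (N1 + N2) * x := by
      apply hj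
      simp only [map_mul, map_pow, h, h1, h2]; ring
    have h3 : x1 * x2 ∈ c := hcancel N _ (by rw [this]; exact c.mul_mem_left _ hx)
    rcases hc.mem_or_mem h3 with h4 | h4
    · exact Or.inl ((hd _).mpr ⟨N1, x1, h4, h1⟩)
    · exact Or.inr ((hd _).mpr ⟨N2, x2, h4, h2⟩)

theorem loc_le {R M : Type*} [CommRing R] [CommRing M] (j : R →+* M)
    (τ : R) (hloc : ∀ f : M, ∃ (N : ℕ) (x : R), j x = j τ ^ N * f)
    (P Q : Ideal M) [hQ : Q.IsPrime] (hτ : j τ ∉ Q) (h : P.comap j ≤ Q.comap j) : P ≤ Q := by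
  intro f hf
  obtain ⟨N, x, hx⟩ := hloc f
  have h1 : x ∈ P.comap j := by rw [Ideal.mem_comap, hx]; exact P.mul_mem_left _ hf
  have h2 := h h1
  rw [Ideal.mem_comap, hx] at h2
  exact (hQ.mem_or_mem h2).resolve_left fun h => hτ (hQ.mem_of_pow_mem _ h)

theorem transfer1 {R M S T : Type*} [CommRing R] [IsDomain R] [CommRing M] [CommRing S] [CommRing T]
    (j : R →+* M) (hj : Function.Injective j) (J : S →+* T) (hJ : Function.Injective J)
    (a : R →+* S) (b : M →+* T) (hcomm : J.comp a = b.comp j) (τ : R)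
    (hloc : ∀ f : M, ∃ (N : ℕ) (x : R), j x = j τ ^ N * f)
    (hloc' : ∀ f : T, ∃ (N : ℕ) (x : S), J x = J (a τ) ^ N * f)
    (c : Ideal R) [hc : c.IsPrime] (hτ : τ ∉ c)
    (hw : ∀ w : Ideal S, w.IsPrime → w.comap a = ⊥ →
      ∃! η : Ideal S, η.IsPrime ∧ w ≤ η ∧ η.comap a = c) :
    ∃ d : Ideal M, d.IsPrime ∧ d.comap j = c ∧ ∀ w : Ideal T, w.IsPrime → w.comap b = ⊥ →
      ∃! η : Ideal T, η.IsPrime ∧ w ≤ η ∧ η.comap b = d := by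
  obtain ⟨d, hd, hdc⟩ := loc_exists j hj τ hloc c hτ
  have hsq : ∀ η : Ideal T, (η.comap J).comap a = (η.comap b).comap j := by
    intro η; rw [Ideal.comap_comap, hcomm, Ideal.comap_comap]
  have hjd : j τ ∉ d := fun h => hτ (by rw [← hdc]; exact h)
  refine ⟨d, hd, hdc, fun w hwp hwb => ?_⟩
  have hτ0 : τ ≠ 0 := fun h => hτ (h ▸ c.zero_mem)
  obtain ⟨η, ⟨h1, h2, h3⟩, h4⟩ := hw (w.comap J) inferInstance (by
    rw [hsq, hwb, ← RingHom.ker_eq_comap_bot, (RingHom.injective_iff_ker_eq_bot _).mp hj])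
  have hη : a τ ∉ η := fun h => hτ (by rw [← h3]; exact h)
  obtain ⟨μ, hμ, hμη⟩ := loc_exists J hJ (a τ) hloc' η hη
  have hJμ : J (a τ) ∉ μ := fun h => hη (by rw [← hμη]; exact h)
  have hbj : J (a τ) = b (j τ) := RingHom.congr_fun hcomm τ
  refine ⟨μ, ⟨hμ, ?_, ?_⟩, ?_⟩
  · exact loc_le J (a τ) hloc' w μ hJμ (by rw [hμη]; exact h2)
  · have e : (μ.comap b).comap j = d.comap j := by rw [← hsq, hμη, h3, hdc]
    exact le_antisymm (loc_le j τ hloc _ _ hjd e.le)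
      (loc_le j τ hloc _ _ (by rwa [Ideal.mem_comap, ← hbj]) e.ge)
  · rintro ν ⟨hν, hwν, hνd⟩
    have e : ν.comap J = μ.comap J := by
      rw [hμη]
      exact h4 _ ⟨inferInstance, Ideal.comap_mono hwν, by rw [hsq, hνd, hdc]⟩
    have hJν : J (a τ) ∉ ν := by
      rw [hbj, ← Ideal.mem_comap, hνd]; exact hjd
    exact le_antisymm (loc_le J (a τ) hloc' _ _ hJμ e.le) (loc_le J (a τ) hloc' _ _ hJν e.ge)

theorem mvmap_integral {σ A B : Type*} [CommRing A] [CommRing B] (f : A →+* B) (hf : f.IsIntegral) :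
    (MvPolynomial.map f : MvPolynomial σ A →+* MvPolynomial σ B).IsIntegral := by
  intro b
  induction b using MvPolynomial.induction_on with
  | C g =>
    obtain ⟨F, hF, h⟩ := hf g
    refine ⟨F.map MvPolynomial.C, hF.map _, ?_⟩
    rw [eval₂_map]
    have : (MvPolynomial.map f).comp MvPolynomial.C = (MvPolynomial.C : B →+* MvPolynomial σ B).comp f := by
      ext x; simp
    rw [this, ← hom_eval₂, h, map_zero]
  | add p q hp hq => exact RingHom.IsIntegralElem.add _ hp hq
  | mul_X p j hp =>
    refine RingHom.IsIntegralElem.mul _ hp ?_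
    have := (MvPolynomial.map f : MvPolynomial σ A →+* MvPolynomial σ B).isIntegralElem_map
      (x := MvPolynomial.X j)
    simpa using this

theorem mem_ker_map_mk {σ B : Type*} [CommRing B] (η : Ideal B) (f : MvPolynomial σ B) :
    f ∈ RingHom.ker (MvPolynomial.map (Ideal.Quotient.mk η) :
      MvPolynomial σ B →+* MvPolynomial σ (B ⧸ η)) ↔ ∀ d, f.coeff d ∈ η := by
  rw [RingHom.mem_ker, MvPolynomial.ext_iff]
  simp [MvPolynomial.coeff_map, Ideal.Quotient.eq_zero_iff_mem]

theorem transfer2 {σ A B : Type*} [CommRing A] [CommRing B] (a : A →+* B) (ha : a.IsIntegral)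
    (d : Ideal (MvPolynomial σ A)) [hd : d.IsPrime]
    (hw : ∀ w : Ideal (MvPolynomial σ B), w.IsPrime → w.comap (MvPolynomial.map a) = ⊥ →
      ∃! η : Ideal (MvPolynomial σ B), η.IsPrime ∧ w ≤ η ∧ η.comap (MvPolynomial.map a) = d) :
    ∀ w : Ideal B, w.IsPrime → w.comap a = ⊥ →
      ∃! η : Ideal B, η.IsPrime ∧ w ≤ η ∧ η.comap a = d.comap MvPolynomial.C := by
  intro w hwp hwb
  set J : Ideal B → Ideal (MvPolynomial σ B) := fun η =>
    RingHom.ker (MvPolynomial.map (Ideal.Quotient.mk η) :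
      MvPolynomial σ B →+* MvPolynomial σ (B ⧸ η)) with hJ
  have hsq : ∀ μ : Ideal (MvPolynomial σ B), (μ.comap MvPolynomial.C).comap a =
      (μ.comap (MvPolynomial.map a)).comap MvPolynomial.C := by
    intro μ
    rw [Ideal.comap_comap, Ideal.comap_comap]
    congr 1
    ext x; simp
  have hle : ∀ (η : Ideal B) (μ : Ideal (MvPolynomial σ B)), η ≤ μ.comap MvPolynomial.C → J η ≤ μ := by
    intro η μ h f hf
    rw [mem_ker_map_mk] at hf
    rw [MvPolynomial.as_sum f]
    refine Ideal.sum_mem _ fun d _ => ?_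
    rw [MvPolynomial.monomial_eq]
    exact Ideal.mul_mem_right _ _ (h (hf d))
  obtain ⟨μ, ⟨h1, h2, h3⟩, h4⟩ := hw (J w) (RingHom.ker_isPrime _) (by
    rw [eq_bot_iff]
    intro f hf
    rw [Ideal.mem_comap, mem_ker_map_mk] at hf
    rw [Ideal.mem_bot]
    ext d
    have := hf d
    rw [MvPolynomial.coeff_map, ← Ideal.mem_comap, hwb] at this
    simpa using this)
  refine ⟨μ.comap MvPolynomial.C, ⟨inferInstance, ?_, by rw [hsq, h3]⟩, ?_⟩
  · intro x hx
    apply h2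
    rw [mem_ker_map_mk]
    intro d
    classical
    rw [MvPolynomial.coeff_C]
    split_ifs
    · exact hx
    · exact w.zero_mem
  · rintro η ⟨hη, hwη, hηc⟩
    letI := (MvPolynomial.map a : MvPolynomial σ A →+* MvPolynomial σ B).toAlgebra
    have : Algebra.IsIntegral (MvPolynomial σ A) (MvPolynomial σ B) :=
      ⟨fun x => mvmap_integral a ha x⟩
    obtain ⟨Q, hQ1, hQ2, hQ3⟩ := Ideal.exists_ideal_over_prime_of_isIntegral d (J η) (by
      intro f hf
      have hf' : MvPolynomial.map a f ∈ J η := hf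
      rw [mem_ker_map_mk] at hf'
      rw [MvPolynomial.as_sum f]
      refine Ideal.sum_mem _ fun e _ => ?_
      rw [MvPolynomial.monomial_eq]
      refine Ideal.mul_mem_right _ _ ?_
      have := hf' e
      rw [MvPolynomial.coeff_map, ← Ideal.mem_comap, hηc] at this
      exact this)
    have hηQ : η ≤ Q.comap MvPolynomial.C := by
      intro x hx
      apply hQ1
      rw [mem_ker_map_mk]
      intro d
      classical
      rw [MvPolynomial.coeff_C]
      split_ifs
      · exact hx
      · exact η.zero_mem
    have hQμ : Q = μ := h4 Q ⟨hQ2, hle _ _ (hwη.trans hηQ), hQ3⟩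
    rw [← hQμ]
    refine incomp a ha hηQ ?_
    rw [hηc, hsq]
    congr 1
    exact hQ3.symm
end Hit

end

section
open Polynomial
open scoped TensorProduct
namespace Hit
set_option linter.style.haveILetI false

theorem tens_equiv (K k A σ : Type*) [Field K] [Field k] [CommRing A] [Algebra K k] [Algebra K A] :
    ∃ E : (MvPolynomial σ A) ⊗[K] k ≃+* MvPolynomial σ (A ⊗[K] k),
      ∀ m, E (m ⊗ₜ 1) = MvPolynomial.map (algebraMap A (A ⊗[K] k)) m := by
  refine ⟨((Algebra.TensorProduct.comm K (MvPolynomial σ A) k).toRingEquiv.trans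
    (MvPolynomial.rTensorAlgEquiv (R := K) (S := k) (N := A) (σ := σ)).toRingEquiv).trans
    (MvPolynomial.mapEquiv σ (Algebra.TensorProduct.comm K k A).toRingEquiv), fun m => ?_⟩
  ext d
  have h := MvPolynomial.coeff_rTensorAlgEquiv_tmul (R := K) (S := k) (N := A) (σ := σ) 1 m d
  simp only [RingEquiv.trans_apply, MvPolynomial.mapEquiv_apply, MvPolynomial.coeff_map,
    Algebra.TensorProduct.algebraMap_apply]
  change (Algebra.TensorProduct.comm K k A) (MvPolynomial.coeff d (MvPolynomial.rTensorAlgEquiv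
    (Algebra.TensorProduct.comm K (MvPolynomial σ A) k (m ⊗ₜ 1)))) = _
  rw [Algebra.TensorProduct.comm_tmul, h, Algebra.TensorProduct.comm_tmul]
  rfl

theorem trdeg_comap {K A M : Type u} [Field K] [CommRing M] [Algebra K M] [CommRing A] [Algebra K A]
    (φ : A →ₐ[K] M) (d : Ideal M) (c : Ideal A) (hc : ∀ a, a ∈ c ↔ φ a ∈ d) :
    Algebra.trdeg K (A ⧸ c) ≤ Algebra.trdeg K (M ⧸ d) := by
  have e : c = d.comap φ := by ext a; exact hc a
  subst e
  refine trdeg_le_of_injective (Ideal.quotientMapₐ d φ le_rfl) ?_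
  exact Ideal.quotientMap_injective (f := φ.toRingHom) (I := d)

theorem trdeg_aux {K M : Type u} [Field K] [CommRing M] [Algebra K M] (R₀ : Subalgebra K M)
    (d : Ideal M) [d.IsPrime] (t τ : R₀) (hτc : (τ : M) ∉ d)
    (ht : ∀ r : R₀, ∃ f : K[X][X], f.Monic ∧ ((eval₂ (aeval t : K[X] →ₐ[K] R₀).toRingHom r f : R₀) : M) ∈ d)
    (hmemM : ∀ f : M, ∃ N : ℕ, (τ : M) ^ N * f ∈ R₀) : Algebra.trdeg K (M ⧸ d) ≤ 1 := by
  let tq : M ⧸ d := Ideal.Quotient.mk d (t : M)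
  have hintg : ∀ r : R₀, IsAlgebraic (Algebra.adjoin K {tq}) (Ideal.Quotient.mk d (r : M)) := by
    intro r
    obtain ⟨F, hF, hFr⟩ := ht r
    apply IsIntegral.isAlgebraic
    have htm : tq ∈ Algebra.adjoin K {tq} := Algebra.subset_adjoin rfl
    let θ : K[X] →ₐ[K] Algebra.adjoin K {tq} := aeval ⟨tq, htm⟩
    refine ⟨F.map θ.toRingHom, hF.map _, ?_⟩
    rw [eval₂_map]
    have h1 := hFr
    have h2 := Ideal.Quotient.eq_zero_iff_mem.mpr h1
    rw [← h2]
    let π : R₀ →+* M ⧸ d := (Ideal.Quotient.mk d).comp R₀.val.toRingHom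
    have h3 : (algebraMap (Algebra.adjoin K {tq}) (M ⧸ d)).comp θ.toRingHom =
        π.comp (aeval t : K[X] →ₐ[K] R₀).toRingHom := by
      apply Polynomial.ringHom_ext
      · intro a
        simp [θ, π]
      · simp [θ, π]
        rfl
    rw [h3]
    exact (hom_eval₂ F _ π r).symm
  have : Algebra.IsAlgebraic (Algebra.adjoin K {tq}) (M ⧸ d) := by
    constructor
    intro q
    obtain ⟨f, rfl⟩ := Ideal.Quotient.mk_surjective q
    obtain ⟨N, hN⟩ := hmemM f
    have h1 := hintg ⟨_, hN⟩
    have h2 := (hintg τ).pow N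
    have hne : (Ideal.Quotient.mk d (τ : M)) ^ N ≠ 0 := by
      apply pow_ne_zero
      rw [Ne, Ideal.Quotient.eq_zero_iff_mem]
      exact hτc
    refine IsAlgebraic.of_mul (mem_nonZeroDivisors_of_ne_zero hne) h2 ?_
    rw [← map_pow, ← map_mul]
    exact h1
  simpa using Algebra.IsAlgebraic.trdeg_le_cardinalMk K ({tq} : Set (M ⧸ d))

set_option maxHeartbeats 1000000 in
theorem partIII_core {K k A : Type u} [Field K] [Field k] [Algebra K k] [Algebra.IsAlgebraic K k]
    [Infinite k] [CommRing A] [IsDomain A] [Algebra K A]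
    {ι : Type} [Finite ι] (S : ι → Subalgebra K A) (hS : ∀ i, (S i).FG) (i₀ : ι) (hi₀ : S i₀ = ⊤)
    (β : ∀ i, S i →ₐ[K] k) (h : A) (hh : h ≠ 0) :
    ∃ c : Ideal A, c.IsPrime ∧ h ∉ c ∧ (∀ i (b : S i), (b : A) ∈ c → β i b = 0) ∧
      Algebra.trdeg K (A ⧸ c) ≤ 1 ∧
      ∀ w : Ideal (A ⊗[K] k), w.IsPrime → w.comap (algebraMap A (A ⊗[K] k)) = ⊥ →
        ∃! η : Ideal (A ⊗[K] k), η.IsPrime ∧ w ≤ η ∧ η.comap (algebraMap A (A ⊗[K] k)) = c := by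
  classical
  choose G hG using hS
  let R₀ : Subalgebra K (MvPolynomial ι A) := Algebra.adjoin K
    (Set.range (MvPolynomial.X : ι → MvPolynomial ι A) ∪
      ⋃ i, (fun b => MvPolynomial.X i * MvPolynomial.C b) '' (G i : Set A))
  have hXR : ∀ i, (MvPolynomial.X i : MvPolynomial ι A) ∈ R₀ := fun i =>
    Algebra.subset_adjoin (Or.inl ⟨i, rfl⟩)
  have hft : Algebra.FiniteType K R₀ := by
    rw [← Subalgebra.fg_iff_finiteType]
    refine Subalgebra.fg_def.mpr ⟨_, ?_, rfl⟩
    exact (Set.finite_range _).union (Set.finite_iUnion fun i => (G i).finite_toSet.image _)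
  have hCalg : ∀ r : K, (MvPolynomial.C (algebraMap K A r) : MvPolynomial ι A) =
      algebraMap K (MvPolynomial ι A) r := fun r => by
    rw [IsScalarTower.algebraMap_apply K A (MvPolynomial ι A)]; rfl
  have hmemS : ∀ i (b : A), b ∈ S i → ∃ N : ℕ,
      (MvPolynomial.X i ^ N * MvPolynomial.C b : MvPolynomial ι A) ∈ R₀ := by
    intro i b hb
    rw [← hG i] at hb
    induction hb using Algebra.adjoin_induction with
    | mem x hx =>
      refine ⟨1, Algebra.subset_adjoin (Or.inr ?_)⟩
      exact Set.mem_iUnion.mpr ⟨i, x, hx, by simp⟩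
    | algebraMap r =>
      refine ⟨0, ?_⟩
      rw [pow_zero, one_mul, hCalg]
      exact R₀.algebraMap_mem r
    | add x y _ _ hx hy =>
      obtain ⟨N, hN⟩ := hx
      obtain ⟨M, hM⟩ := hy
      refine ⟨N + M, ?_⟩
      have := R₀.add_mem (R₀.mul_mem (R₀.pow_mem (hXR i) M) hN) (R₀.mul_mem (R₀.pow_mem (hXR i) N) hM)
      convert this using 1
      rw [MvPolynomial.C_add]; ring
    | mul x y _ _ hx hy =>
      obtain ⟨N, hN⟩ := hx
      obtain ⟨M, hM⟩ := hy
      refine ⟨N + M, ?_⟩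
      have := R₀.mul_mem hN hM
      convert this using 1
      rw [MvPolynomial.C_mul]; ring
  have hmemM : ∀ f : MvPolynomial ι A, ∃ N : ℕ, MvPolynomial.X i₀ ^ N * f ∈ R₀ := by
    intro f
    induction f using MvPolynomial.induction_on with
    | C a => exact hmemS i₀ a (by rw [hi₀]; trivial)
    | add x y hx hy =>
      obtain ⟨N, hN⟩ := hx
      obtain ⟨M, hM⟩ := hy
      refine ⟨N + M, ?_⟩
      have := R₀.add_mem (R₀.mul_mem (R₀.pow_mem (hXR i₀) M) hN) (R₀.mul_mem (R₀.pow_mem (hXR i₀) N) hM)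
      convert this using 1
      ring
    | mul_X p j hp =>
      obtain ⟨N, hN⟩ := hp
      refine ⟨N, ?_⟩
      rw [← mul_assoc]
      exact R₀.mul_mem hN (hXR j)
  let ev : ι → (MvPolynomial ι A →ₐ[K] A) := fun i =>
    (MvPolynomial.aeval (Pi.single i (1 : A)) : MvPolynomial ι A →ₐ[A] A).restrictScalars K
  have hevX : ∀ i j, ev i (MvPolynomial.X j) = (Pi.single i (1 : A) : ι → A) j := fun i j =>
    MvPolynomial.aeval_X _ _
  have hevC : ∀ i a, ev i (MvPolynomial.C a) = a := fun i a => MvPolynomial.aeval_C _ _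
  have hevS : ∀ i, R₀ ≤ (S i).comap (ev i) := by
    intro i
    refine Algebra.adjoin_le ?_
    have hX : ∀ j, ev i (MvPolynomial.X j) ∈ S i := by
      intro j
      rw [hevX]
      by_cases hj : j = i
      · subst hj; rw [Pi.single_eq_same]; exact (S j).one_mem
      · rw [Pi.single_eq_of_ne hj]; exact (S i).zero_mem
    rintro y (⟨j, rfl⟩ | hy)
    · exact hX j
    · obtain ⟨j, b, hb, rfl⟩ := Set.mem_iUnion.mp hy
      change ev i (MvPolynomial.X j * MvPolynomial.C b) ∈ S i
      rw [map_mul, hevC, hevX]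
      by_cases hj : j = i
      · subst hj
        rw [Pi.single_eq_same, one_mul, ← hG]
        exact Algebra.subset_adjoin hb
      · rw [Pi.single_eq_of_ne hj, zero_mul]; exact (S i).zero_mem
  let χ : ι → (R₀ →ₐ[K] k) := fun i =>
    (β i).comp (((ev i).comp R₀.val).codRestrict (S i) (fun x => hevS i x.2))
  have hχ : ∀ i (y : R₀) (hy : ev i y ∈ S i), χ i y = β i ⟨ev i y, hy⟩ := fun i y hy => rfl
  let τ : R₀ := ⟨MvPolynomial.X i₀, hXR i₀⟩
  have htr : ¬ Algebra.IsAlgebraic K R₀ := by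
    intro halg
    have h1 : IsAlgebraic K τ := halg.isAlgebraic τ
    have h2 : IsAlgebraic K (MvPolynomial.X i₀ : MvPolynomial ι A) := h1.algHom R₀.val
    have h3 : IsAlgebraic A (MvPolynomial.X i₀ : MvPolynomial ι A) := h2.extendScalars (FaithfulSMul.algebraMap_injective K A)
    exact MvPolynomial.transcendental_X A i₀ h3
  obtain ⟨N₀, hN₀⟩ := hmemM (MvPolynomial.C h)
  obtain ⟨c', hc', hhc', hker, ⟨t, ht⟩, hw⟩ := partII (k := k) htr χ ⟨_, hN₀⟩ (by
    intro e
    have e' : (MvPolynomial.X i₀ ^ N₀ * MvPolynomial.C h : MvPolynomial ι A) = 0 := congrArg Subtype.val e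
    rcases mul_eq_zero.mp e' with e | e
    · exact MvPolynomial.X_ne_zero i₀ (by by_contra hX; exact pow_ne_zero N₀ hX e)
    · exact hh (MvPolynomial.C_eq_zero.mp e))
  have hτc : τ ∉ c' := by
    intro hτ
    have h1 := hker i₀ hτ
    rw [RingHom.mem_ker] at h1
    have h2 : χ i₀ τ = 0 := h1
    have h3 : ev i₀ (τ : MvPolynomial ι A) = 1 := by
      change ev i₀ (MvPolynomial.X i₀) = 1
      rw [hevX, Pi.single_eq_same]
    rw [hχ i₀ τ (by rw [h3]; exact (S i₀).one_mem)] at h2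
    have h4 : (⟨ev i₀ τ, by rw [h3]; exact (S i₀).one_mem⟩ : S i₀) = 1 := Subtype.ext h3
    rw [h4, map_one] at h2
    exact one_ne_zero h2
  obtain ⟨E, hE⟩ := tens_equiv K k A ι
  let J₁ : R₀ ⊗[K] k →ₐ[K] (MvPolynomial ι A) ⊗[K] k :=
    Algebra.TensorProduct.map R₀.val (AlgHom.id K k)
  have hJ₁ : Function.Injective J₁ := 
    Module.Flat.rTensor_preserves_injective_linearMap (M := k) R₀.val.toLinearMap Subtype.val_injective
  have hJt : ∀ (y : R₀) s, J₁ (y ⊗ₜ s) = (y : MvPolynomial ι A) ⊗ₜ s := fun y s => rfl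
  let J : R₀ ⊗[K] k →+* MvPolynomial ι (A ⊗[K] k) := E.toRingHom.comp J₁.toRingHom
  have hJa : ∀ z, J z = E (J₁ z) := fun z => rfl
  have haR : ∀ y : R₀, algebraMap R₀ (R₀ ⊗[K] k) y = y ⊗ₜ 1 := fun y => rfl
  have hcomm : J.comp (algebraMap R₀ (R₀ ⊗[K] k)) =
      (MvPolynomial.map (algebraMap A (A ⊗[K] k))).comp R₀.val.toRingHom := by
    refine RingHom.ext fun y => ?_
    change E (J₁ (algebraMap R₀ (R₀ ⊗[K] k) y)) = _
    rw [haR, hJt, hE]; rfl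
  have hloc' : ∀ f : MvPolynomial ι (A ⊗[K] k), ∃ (N : ℕ) (x : R₀ ⊗[K] k),
      J x = J (algebraMap R₀ (R₀ ⊗[K] k) τ) ^ N * f := by
    intro f
    obtain ⟨z, rfl⟩ := E.surjective f
    induction z using TensorProduct.induction_on with
    | zero => exact ⟨0, 0, by rw [map_zero, map_zero, mul_zero]⟩
    | tmul m s =>
      obtain ⟨N, hN⟩ := hmemM m
      refine ⟨N, (⟨_, hN⟩ : R₀) ⊗ₜ s, ?_⟩
      rw [hJa, hJa, hJt, ← map_pow, ← map_mul, haR, hJt, Algebra.TensorProduct.tmul_pow,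
        Algebra.TensorProduct.tmul_mul_tmul, one_pow, one_mul]
    | add z₁ z₂ h1 h2 =>
      obtain ⟨N, y, hy⟩ := h1
      obtain ⟨M, y', hy'⟩ := h2
      refine ⟨N + M, (algebraMap R₀ (R₀ ⊗[K] k) τ) ^ M * y + (algebraMap R₀ (R₀ ⊗[K] k) τ) ^ N * y', ?_⟩
      rw [map_add, map_mul, map_mul, map_pow, map_pow, hy, hy', map_add]; ring
  obtain ⟨d, hd, hdc, hdw⟩ := transfer1 (S := R₀ ⊗[K] k) (T := MvPolynomial ι (A ⊗[K] k)) R₀.val.toRingHom Subtype.val_injective J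
    (E.injective.comp hJ₁) (algebraMap R₀ (R₀ ⊗[K] k))
    (MvPolynomial.map (algebraMap A (A ⊗[K] k))) hcomm τ
    (by
      intro f
      obtain ⟨N, hN⟩ := hmemM f
      exact ⟨N, ⟨_, hN⟩, rfl⟩)
    hloc'
    c' hτc hw
  have hdc' : ∀ y : R₀, (y : MvPolynomial ι A) ∈ d ↔ y ∈ c' := fun y => by
    rw [← hdc]; rfl
  refine ⟨d.comap MvPolynomial.C, inferInstance, ?_, ?_, ?_, ?_⟩
  · intro hc
    exact hhc' ((hdc' _).mp (d.mul_mem_left _ hc))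
  · intro i b hb
    obtain ⟨N, hN⟩ := hmemS i b b.2
    have h1 : (⟨_, hN⟩ : R₀) ∈ c' := (hdc' _).mp (d.mul_mem_left _ hb)
    have h2 : χ i (⟨_, hN⟩ : R₀) = 0 := hker i h1
    have h3 : ev i ((⟨_, hN⟩ : R₀) : MvPolynomial ι A) = b := by
      change ev i (MvPolynomial.X i ^ N * MvPolynomial.C (b : A)) = b
      rw [map_mul, map_pow, hevC, hevX, Pi.single_eq_same, one_pow, one_mul]
    rw [hχ i _ (by rw [h3]; exact b.2)] at h2
    rw [← h2]
    congr 1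
    exact Subtype.ext h3.symm
  · -- transcendence degree
    refine (trdeg_comap (IsScalarTower.toAlgHom K A (MvPolynomial ι A)) d _ fun a => Iff.rfl).trans ?_
    refine trdeg_aux R₀ d t τ (fun hh => hτc ((hdc' _).mp hh)) (fun r => ?_) hmemM
    obtain ⟨F, hF, hFr⟩ := ht r
    exact ⟨F, hF, (hdc' _).mpr hFr⟩
  · exact transfer2 _ (algebraMap_isIntegral_iff.mpr inferInstance) d hdw
end Hit

end

section
open scoped TensorProduct
namespace Hit
set_option linter.style.haveILetI false

theorem exists_hA {K k A : Type u} [Field K] [Field k] [Algebra K k] [Algebra.IsAlgebraic K k]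
    [CommRing A] [IsDomain A] [Algebra K A] [Algebra.FiniteType K A] :
    ∃ h : A, h ≠ 0 ∧ ∀ w₁ w₂ : Ideal (A ⊗[K] k), w₁.IsPrime → w₂.IsPrime →
      w₁.comap (algebraMap A (A ⊗[K] k)) = ⊥ → w₂.comap (algebraMap A (A ⊗[K] k)) = ⊥ →
      w₁ ≠ w₂ → algebraMap A (A ⊗[K] k) h ∈ w₁ ⊔ w₂ := by
  classical
  haveI := noeth_tensor K k A
  have hintg : (algebraMap A (A ⊗[K] k)).IsIntegral := algebraMap_isIntegral_iff.mpr inferInstance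
  let F : Set (Ideal (A ⊗[K] k)) := {w | w.IsPrime ∧ w.comap (algebraMap A (A ⊗[K] k)) = ⊥}
  have hF : F.Finite := by
    refine (minimalPrimes.finite_of_isNoetherianRing (A ⊗[K] k)).subset ?_
    rintro w ⟨hw, hwb⟩
    refine ⟨⟨hw, bot_le⟩, ?_⟩
    rintro q ⟨hq, -⟩ hqw
    have hq' := hq
    have : q.comap (algebraMap A (A ⊗[K] k)) = w.comap (algebraMap A (A ⊗[K] k)) := by
      rw [hwb, eq_bot_iff, ← hwb]; exact Ideal.comap_mono hqw
    exact (incomp _ hintg hqw this).ge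
  have hpair : ∀ p : Ideal (A ⊗[K] k) × Ideal (A ⊗[K] k), ∃ a : A, a ≠ 0 ∧
      (p.1 ∈ F → p.2 ∈ F → p.1 ≠ p.2 → algebraMap A (A ⊗[K] k) a ∈ p.1 ⊔ p.2) := by
    rintro ⟨w₁, w₂⟩
    by_cases hp : w₁ ∈ F ∧ w₂ ∈ F ∧ w₁ ≠ w₂
    · obtain ⟨⟨h1, h1b⟩, ⟨h2, h2b⟩, hne⟩ := hp
      by_contra hcon
      push Not at hcon
      apply hne
      have hle : (w₁ ⊔ w₂).comap (algebraMap A (A ⊗[K] k)) ≤ ⊥ := by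
        intro a ha
        by_contra h0
        exact (hcon a h0).2.2.2 ha
      obtain ⟨Q, hQ, hQp, hQc⟩ := Ideal.exists_ideal_over_prime_of_isIntegral (⊥ : Ideal A) _ hle
      have e1 := incomp _ hintg (le_sup_left.trans hQ) (h1b.trans hQc.symm)
      have e2 := incomp _ hintg (le_sup_right.trans hQ) (h2b.trans hQc.symm)
      exact e1.trans e2.symm
    · exact ⟨1, one_ne_zero, fun h1 h2 h3 => absurd ⟨h1, h2, h3⟩ hp⟩
  choose a ha0 ha using hpair
  refine ⟨∏ p ∈ hF.toFinset ×ˢ hF.toFinset, a p, Finset.prod_ne_zero_iff.mpr fun p _ => ha0 p, ?_⟩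
  intro w₁ w₂ h1 h2 h1b h2b hne
  have hmem : (w₁, w₂) ∈ hF.toFinset ×ˢ hF.toFinset := by
    rw [Finset.mem_product]
    exact ⟨hF.mem_toFinset.mpr ⟨h1, h1b⟩, hF.mem_toFinset.mpr ⟨h2, h2b⟩⟩
  rw [map_prod]
  exact Ideal.mem_of_dvd _ (Finset.dvd_prod_of_mem _ hmem) (ha (w₁, w₂) ⟨h1, h1b⟩ ⟨h2, h2b⟩ hne)

theorem exists_pt {K k A : Type u} [Field K] [Field k] [Algebra K k] [IsAlgClosed k]
    [CommRing A] [Algebra K A] [Algebra.FiniteType K A] (m : Ideal A) [m.IsMaximal] :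
    ∃ β : A →ₐ[K] k, RingHom.ker β = m := by
  letI := Ideal.Quotient.field m
  haveI : Module.Finite K (A ⧸ m) := finite_of_finite_type_of_isJacobsonRing K (A ⧸ m)
  let g : A ⧸ m →ₐ[K] k := IsAlgClosed.lift
  refine ⟨g.comp (Ideal.Quotient.mkₐ K m), ?_⟩
  ext a
  rw [RingHom.mem_ker, AlgHom.comp_apply, map_eq_zero_iff g g.toRingHom.injective]
  exact Ideal.Quotient.eq_zero_iff_mem

theorem two_max {K A : Type u} [Field K] [CommRing A] [IsDomain A] [Algebra K A]
    [Algebra.FiniteType K A] (hA : ¬ IsField A) :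
    ∃ m₁ m₂ : Ideal A, m₁.IsMaximal ∧ m₂.IsMaximal ∧ m₁ ≠ m₂ := by
  haveI : IsJacobsonRing A := isJacobsonRing_of_finiteType (A := K)
  obtain ⟨m, hm⟩ := Ideal.exists_maximal A
  have hmb : m ≠ ⊥ := by
    rintro rfl
    exact Ring.ne_bot_of_isMaximal_of_not_isField hm hA rfl
  obtain ⟨a, ham, ha0⟩ := Submodule.exists_mem_ne_zero_of_ne_bot hmb
  have hj : (⊥ : Ideal A).jacobson = ⊥ :=
    IsJacobsonRing.out ‹_› (Ideal.IsPrime.isRadical Ideal.isPrime_bot)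
  have : a ∉ (⊥ : Ideal A).jacobson := by rw [hj]; exact ha0
  rw [Ideal.jacobson, Ideal.mem_sInf] at this
  push Not at this
  obtain ⟨m', ⟨-, hm'⟩, ham'⟩ := this
  exact ⟨m, m', hm, hm', fun e => ham' (e ▸ ham)⟩

theorem ALG {K k A : Type u} [Field K] [Field k] [Algebra K k] [Algebra.IsAlgebraic K k] [IsAlgClosed k]
    [CommRing A] [IsDomain A] [Algebra K A] [Algebra.FiniteType K A] (hA : ¬ IsField A)
    {ι : Type} [Finite ι] (S : ι → Subalgebra K A) (hS : ∀ i, (S i).FG)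
    (β : ∀ i, S i →ₐ[K] k) :
    ∃ c : Ideal A, c.IsPrime ∧ ¬ c.IsMaximal ∧ (∀ i (b : S i), (b : A) ∈ c → β i b = 0) ∧
      Algebra.trdeg K (A ⧸ c) ≤ 1 ∧
      (∀ w : Ideal (A ⊗[K] k), w.IsPrime → w.comap (algebraMap A (A ⊗[K] k)) = ⊥ →
        ∃! η : Ideal (A ⊗[K] k), η.IsPrime ∧ w ≤ η ∧ η.comap (algebraMap A (A ⊗[K] k)) = c) ∧
      (∀ η : Ideal (A ⊗[K] k), η.IsPrime → η.comap (algebraMap A (A ⊗[K] k)) = c →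
        ∃! w : Ideal (A ⊗[K] k), w.IsPrime ∧ w ≤ η ∧ w.comap (algebraMap A (A ⊗[K] k)) = ⊥) := by
  haveI : Infinite k := IsAlgClosed.instInfinite
  obtain ⟨m₁, m₂, hm₁, hm₂, hne⟩ := two_max (K := K) hA
  obtain ⟨β₁, hβ₁⟩ := exists_pt (K := K) (k := k) m₁
  obtain ⟨β₂, hβ₂⟩ := exists_pt (K := K) (k := k) m₂
  obtain ⟨h, hh, hw⟩ := exists_hA (K := K) (k := k) (A := A)
  let S' : ι ⊕ Bool → Subalgebra K A := Sum.elim S fun _ => ⊤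
  let β' : ∀ i, S' i →ₐ[K] k := fun i => match i with
    | Sum.inl i => β i
    | Sum.inr true => β₁.comp (⊤ : Subalgebra K A).val
    | Sum.inr false => β₂.comp (⊤ : Subalgebra K A).val
  obtain ⟨c, hc, hhc, hcβ, htr, hu⟩ := partIII_core S' (by
    rintro (i | b)
    · exact hS i
    · exact Algebra.FiniteType.out) (Sum.inr true) rfl β' h hh
  have hc1 : c ≤ m₁ := by
    intro a ha
    rw [← hβ₁]
    exact hcβ (Sum.inr true) ⟨a, trivial⟩ ha
  have hc2 : c ≤ m₂ := by
    intro a ha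
    rw [← hβ₂]
    exact hcβ (Sum.inr false) ⟨a, trivial⟩ ha
  refine ⟨c, hc, ?_, fun i b hb => hcβ (Sum.inl i) b hb, htr, hu, ?_⟩
  · intro hcm
    exact hne ((hcm.eq_of_le hm₁.ne_top hc1).symm.trans (hcm.eq_of_le hm₂.ne_top hc2))
  · intro η hη hηc
    haveI : η.LiesOver c := ⟨hηc.symm⟩
    haveI : (⊥ : Ideal A).IsPrime := Ideal.isPrime_bot
    obtain ⟨w, hwη, hwp, hwl⟩ := Ideal.exists_ideal_le_liesOver_of_le (p := (⊥ : Ideal A)) (q := c) η bot_le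
    refine ⟨w, ⟨hwp, hwη, hwl.over.symm⟩, ?_⟩
    rintro w' ⟨hw'p, hw'η, hw'b⟩
    by_contra hne'
    have := hw w' w hw'p hwp hw'b hwl.over.symm hne'
    exact hhc (hηc ▸ (sup_le hw'η hwη this : _ ∈ η.comap _))
end Hit

end

section
namespace Hit
set_option linter.style.haveILetI false

theorem dimOneAlg {K B : Type u} [Field K] [CommRing B] [IsDomain B] [Algebra K B]
    [Algebra.FiniteType K B] (htr : Algebra.trdeg K B ≤ 1) (q : Ideal B) [q.IsPrime] (hq : q ≠ ⊥) :
    q.IsMaximal := by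
  obtain ⟨s, g, hg, hfin⟩ := exists_finite_inj_algHom_of_fg K B
  have hs : s ≤ 1 := by
    have h1 := lift_trdeg_le_of_injective g hg
    rw [MvPolynomial.trdeg_of_isDomain] at h1
    have h2 := h1.trans (Cardinal.lift_le.mpr htr)
    simpa using h2
  have hdim : Ring.KrullDimLE 1 (MvPolynomial (Fin s) K) := by
    rw [Ring.krullDimLE_iff, MvPolynomial.ringKrullDim_of_isNoetherianRing, ringKrullDim_eq_zero_of_field]
    simpa using hs
  have hintg : g.toRingHom.IsIntegral := RingHom.Finite.to_isIntegral hfin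
  have hne : q.comap g.toRingHom ≠ ⊥ := by
    intro e
    apply hq
    refine (incomp g.toRingHom hintg bot_le ?_).symm
    rw [e, ← RingHom.ker_eq_comap_bot]
    exact (RingHom.injective_iff_ker_eq_bot _).mp hg
  exact Ideal.isMaximal_of_isIntegral_of_isMaximal_comap' _ hintg q
    (Ideal.isMaximal_of_isPrime_of_ne_bot _ hne)

theorem dimB {K A B κ : Type u} [Field K] [CommRing A] [CommRing B] [Field κ] [Algebra K A]
    [Algebra K B] [Algebra K κ] [Algebra.FiniteType K B] (ρA : A →ₐ[K] κ) (ρB : B →ₐ[K] κ)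
    (htr : Algebra.trdeg K (A ⧸ RingHom.ker ρA) ≤ 1)
    (hfrac : ∀ z : κ, ∃ a s : A, ρA s ≠ 0 ∧ ρA s * z = ρA a)
    (q : Ideal B) [hqp : q.IsPrime] (hle : RingHom.ker ρB ≤ q) (hne : RingHom.ker ρB ≠ q) :
    q.IsMaximal := by
  let e : (A ⧸ RingHom.ker ρA) ≃ₐ[K] ρA.range := Ideal.quotientKerEquivRange ρA
  have h1 : Algebra.trdeg K ρA.range ≤ 1 := by rw [← e.trdeg_eq]; exact htr
  have halg : Algebra.IsAlgebraic ρA.range κ := by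
    constructor
    intro z
    obtain ⟨a, s, hs, h⟩ := hfrac z
    refine IsAlgebraic.of_mul (y := ρA s) (mem_nonZeroDivisors_of_ne_zero hs) ?_ ?_
    · exact isAlgebraic_algebraMap (⟨ρA s, s, rfl⟩ : ρA.range)
    · rw [h]; exact isAlgebraic_algebraMap (⟨ρA a, a, rfl⟩ : ρA.range)
  have h2 : Algebra.trdeg K κ ≤ 1 := by
    rw [← trdeg_add_eq K ρA.range, trdeg_eq_zero (R := ρA.range) (A := κ), add_zero]
    exact h1
  have hBd : (RingHom.ker ρB).IsPrime := RingHom.ker_isPrime _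
  let B' := B ⧸ RingHom.ker ρB
  have h3 : Algebra.trdeg K (B ⧸ RingHom.ker ρB) ≤ 1 :=
    (trdeg_le_of_injective (Ideal.kerLiftAlg ρB) (Ideal.kerLiftAlg_injective ρB)).trans h2
  have hsurj : Function.Surjective (Ideal.Quotient.mk (RingHom.ker ρB)) := Ideal.Quotient.mk_surjective
  have hq' : (q.map (Ideal.Quotient.mk (RingHom.ker ρB))).IsPrime :=
    Ideal.map_isPrime_of_surjective hsurj (by rwa [Ideal.mk_ker])
  have hback : (q.map (Ideal.Quotient.mk (RingHom.ker ρB))).comap (Ideal.Quotient.mk (RingHom.ker ρB)) = q := by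
    rw [Ideal.comap_map_of_surjective' _ hsurj, Ideal.mk_ker, sup_eq_left]
    exact hle
  have hm := dimOneAlg h3 (q.map (Ideal.Quotient.mk (RingHom.ker ρB))) (by
    intro e
    apply hne
    rw [e, ← RingHom.ker_eq_comap_bot, Ideal.mk_ker] at hback
    exact hback)
  rw [← hback]
  exact Ideal.comap_isMaximal_of_surjective _ hsurj
end Hit

end

section
namespace Hit
set_option linter.style.haveILetI false
open TopologicalSpace

theorem dimOneTop {X : Type*} [TopologicalSpace X] [QuasiSober X] [T0Space X] (y : X)
    (h1 : ∃ z, y ⤳ z ∧ z ≠ y) (h2 : ∀ z z', y ⤳ z → z ⤳ z' → z = y ∨ z = z') :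
    topologicalKrullDim (closure ({y} : Set X)) = 1 := by
  have hqs : QuasiSober (closure ({y} : Set X)) :=
    (isClosed_closure (s := ({y} : Set X))).isClosedEmbedding_subtypeVal.quasiSober
  letI := specializationOrder (closure ({y} : Set X))
  have hlt : ∀ a b : closure ({y} : Set X), a ≤ b ↔ (b : X) ⤳ (a : X) := by
    intro a b
    change b ⤳ a ↔ _
    exact Topology.IsInducing.subtypeVal.specializes_iff.symm
  have hmem : ∀ z, z ∈ closure ({y} : Set X) ↔ y ⤳ z := fun z => specializes_iff_mem_closure.symm
  have e : topologicalKrullDim (closure ({y} : Set X)) = Order.krullDim (closure ({y} : Set X)) :=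
    Order.krullDim_eq_of_orderIso (irreducibleSetEquivPoints (α := closure ({y} : Set X)))
  rw [e]
  apply le_antisymm
  · rw [Order.krullDim_le_one_iff]
    rintro ⟨z, hz⟩
    by_cases hzy : z = y
    · right
      subst hzy
      rintro ⟨b, hb⟩ -
      rw [hlt]
      exact (hmem b).mp hb
    · left
      rintro ⟨b, hb⟩ hbz
      rw [hlt] at hbz ⊢
      rcases h2 z b ((hmem z).mp hz) hbz with h | h
      · exact absurd h hzy
      · subst h; exact specializes_rfl
  · rw [Order.one_le_krullDim_iff]
    obtain ⟨z, hz, hzy⟩ := h1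
    refine ⟨⟨z, (hmem z).mpr hz⟩, ⟨y, (hmem y).mpr specializes_rfl⟩, ?_⟩
    refine lt_of_le_of_ne ((hlt _ _).mpr hz) fun h => hzy (congrArg Subtype.val h)

theorem equiv_of_rel {α β : Type*} (r : α → β → Prop) (h1 : ∀ a, ∃! b, r a b) (h2 : ∀ b, ∃! a, r a b) :
    ∃ φ : α ≃ β, ∀ a, r a (φ a) := by
  choose f hf hf' using h1
  choose g hg hg' using h2
  exact ⟨⟨f, g, fun a => (hg' _ _ (hf a)).symm, fun b => (hf' _ _ (hg b)).symm⟩, hf⟩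

theorem comp_iff {X Y : Type*} [TopologicalSpace X] [TopologicalSpace Y] [T0Space X]
    [QuasiSober Y] [T0Space Y] (p : Y → X) (hp : Continuous p) (hg : GeneralizingMap p)
    (y : X) (hinc : ∀ a b : Y, p a = y → p b = y → a ⤳ b → a = b) (s : Set Y) :
    (s ⊆ p ⁻¹' (closure {y}) ∧ IsIrreducible s ∧ ∀ t : Set Y, t ⊆ p ⁻¹' (closure {y}) → IsIrreducible t →
      s ⊆ t → t = s) ↔ ∃ η, p η = y ∧ s = closure {η} := by
  have hC : IsClosed (p ⁻¹' (closure {y})) := isClosed_closure.preimage hp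
  constructor
  · rintro ⟨hs, hirr, hmax⟩
    have h1 : closure s = s := hmax _ (closure_minimal hs hC) hirr.closure subset_closure
    obtain ⟨η, hη⟩ := QuasiSober.sober hirr (closure_eq_iff_isClosed.mp h1)
    have h2 : closure {η} = s := hη
    have h3 : y ⤳ p η := specializes_iff_mem_closure.mpr (hs (h2 ▸ subset_closure rfl))
    obtain ⟨η', hη', hpη'⟩ := hg h3
    refine ⟨η', hpη', ?_⟩
    refine (hmax _ ?_ isIrreducible_singleton.closure ?_).symm
    · refine closure_minimal ?_ hC
      rintro _ rfl
      exact hpη' ▸ subset_closure rfl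
    · rw [← h2]
      exact Specializes.closure_subset hη'
  · rintro ⟨η, hη, rfl⟩
    refine ⟨?_, isIrreducible_singleton.closure, ?_⟩
    · refine closure_minimal ?_ hC
      rintro _ rfl
      exact hη ▸ subset_closure rfl
    · intro t ht hirr hle
      obtain ⟨η', hη'⟩ := QuasiSober.sober hirr.closure isClosed_closure
      have h2 : closure {η'} = closure t := hη'
      have h3 : η' ⤳ η := specializes_iff_mem_closure.mpr
        (h2 ▸ subset_closure (hle (subset_closure rfl)))
      have h4 : y ⤳ p η' := specializes_iff_mem_closure.mpr
        (closure_minimal ht hC (h2 ▸ subset_closure rfl))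
      have h5 : p η' = y := ((h3.map hp).trans (hη ▸ specializes_rfl)).antisymm h4 |>.eq
      have h6 := hinc η' η h5 hη h3
      subst h6
      exact Set.Subset.antisymm (h2 ▸ subset_closure) hle

theorem comp_bij {X Y : Type*} [TopologicalSpace X] [TopologicalSpace Y] [T0Space X]
    [QuasiSober Y] [T0Space Y] (p : Y → X) (hp : Continuous p) (hg : GeneralizingMap p)
    (y ξ : X) (hξ : ∀ z, ξ ⤳ z)
    (hincy : ∀ a b : Y, p a = y → p b = y → a ⤳ b → a = b)
    (hincξ : ∀ a b : Y, p a = ξ → p b = ξ → a ⤳ b → a = b)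
    (h4 : ∀ w, p w = ξ → ∃! η, w ⤳ η ∧ p η = y)
    (h5 : ∀ η, p η = y → ∃! w, w ⤳ η ∧ p w = ξ) (P : Set Y → Prop)
    (hP : ∀ s, P s ↔ (s ⊆ p ⁻¹' (closure {y}) ∧ IsIrreducible s ∧
      ∀ t : Set Y, t ⊆ p ⁻¹' (closure {y}) → IsIrreducible t → s ⊆ t → t = s)) :
    ∃ φ : {s : Set Y // P s} ≃ {s : Set Y // s ∈ irreducibleComponents Y},
      (∀ Z : {s : Set Y // P s}, (Z : Set Y) ⊆ (φ Z : Set Y)) ∧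
      ∀ W ∈ irreducibleComponents Y, ∃! Z : Set Y, P Z ∧ Z ⊆ W := by
  have hcl : closure ({ξ} : Set X) = Set.univ :=
    Set.eq_univ_of_forall fun z => specializes_iff_mem_closure.mp (hξ z)
  have hPs : ∀ s, P s ↔ ∃ η, p η = y ∧ s = closure {η} := fun s =>
    (hP s).trans (comp_iff p hp hg y hincy s)
  have hQs : ∀ s, s ∈ irreducibleComponents Y ↔ ∃ w, p w = ξ ∧ s = closure {w} := by
    intro s
    rw [← comp_iff p hp hg ξ hincξ s, hcl]
    simp only [Set.preimage_univ, Set.subset_univ, true_and, forall_const]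
    constructor
    · rintro ⟨h1, h2⟩
      exact ⟨h1, fun t ht hst => Set.Subset.antisymm (h2 ht hst) hst⟩
    · rintro ⟨h1, h2⟩
      exact ⟨h1, fun t ht hst => (h2 t ht hst).le⟩
  have hsub : ∀ a b : Y, closure ({a} : Set Y) ⊆ closure {b} ↔ b ⤳ a := by
    intro a b
    exact specializes_iff_closure_subset.symm
  have hinj : ∀ a b : Y, closure ({a} : Set Y) = closure {b} → a = b := fun a b h =>
    ((hsub b a).mp h.ge).antisymm ((hsub a b).mp h.le) |>.eq
  have hWZ : ∀ W ∈ irreducibleComponents Y, ∃! Z : Set Y, P Z ∧ Z ⊆ W := by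
    intro W hW
    obtain ⟨w, hw, rfl⟩ := (hQs W).mp hW
    obtain ⟨η, ⟨h1, h2⟩, h3⟩ := h4 w hw
    refine ⟨closure {η}, ⟨(hPs _).mpr ⟨η, h2, rfl⟩, (hsub _ _).mpr h1⟩, ?_⟩
    rintro Z ⟨hZ, hZW⟩
    obtain ⟨η', hη', rfl⟩ := (hPs Z).mp hZ
    rw [h3 η' ⟨(hsub _ _).mp hZW, hη'⟩]
  obtain ⟨φ, hφ⟩ := equiv_of_rel (fun (Z : {s : Set Y // P s})
    (W : {s : Set Y // s ∈ irreducibleComponents Y}) => (Z : Set Y) ⊆ W) (by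
      rintro ⟨Z, hZ⟩
      obtain ⟨η, hη, rfl⟩ := (hPs Z).mp hZ
      obtain ⟨w, ⟨h1, h2⟩, h3⟩ := h5 η hη
      refine ⟨⟨closure {w}, (hQs _).mpr ⟨w, h2, rfl⟩⟩, (hsub _ _).mpr h1, ?_⟩
      rintro ⟨W, hW⟩ hZW
      obtain ⟨w', hw', rfl⟩ := (hQs W).mp hW
      have := h3 w' ⟨(hsub _ _).mp hZW, hw'⟩
      subst this
      rfl) (by
      rintro ⟨W, hW⟩
      obtain ⟨Z, ⟨h1, h2⟩, h3⟩ := hWZ W hW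
      refine ⟨⟨Z, h1⟩, h2, ?_⟩
      rintro ⟨Z', hZ'⟩ h
      exact Subtype.ext (h3 Z' ⟨hZ', h⟩))
  exact ⟨φ, hφ, hWZ⟩
end Hit

end

section
namespace Hit
set_option linter.style.haveILetI false

theorem comp_bij_chart {X Y A T : Type*} [TopologicalSpace X] [TopologicalSpace Y] [T0Space X]
    [QuasiSober Y] [T0Space Y] (p : Y → X) (hp : Continuous p) (hg : GeneralizingMap p)
    [CommRing A] [IsDomain A] [CommRing T] (a : A →+* T) (ha : a.IsIntegral)
    (i : PrimeSpectrum A → X) (hi : Topology.IsEmbedding i)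
    (e : PrimeSpectrum T → Y) (he : Topology.IsEmbedding e)
    (hcomm : ∀ t, p (e t) = i (PrimeSpectrum.comap a t)) (hrange : ∀ z, p z ∈ Set.range i → z ∈ Set.range e)
    (c : PrimeSpectrum A) (hξ : ∀ z, i ⊥ ⤳ z)
    (h4 : ∀ w : Ideal T, w.IsPrime → w.comap a = ⊥ →
        ∃! η : Ideal T, η.IsPrime ∧ w ≤ η ∧ η.comap a = c.asIdeal)
    (h5 : ∀ η : Ideal T, η.IsPrime → η.comap a = c.asIdeal →
        ∃! w : Ideal T, w.IsPrime ∧ w ≤ η ∧ w.comap a = ⊥) (P : Set Y → Prop)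
    (hP : ∀ s, P s ↔ (s ⊆ p ⁻¹' (closure {i c}) ∧ IsIrreducible s ∧
      ∀ t : Set Y, t ⊆ p ⁻¹' (closure {i c}) → IsIrreducible t → s ⊆ t → t = s)) :
    ∃ φ : {s : Set Y // P s} ≃ {s : Set Y // s ∈ irreducibleComponents Y},
      (∀ Z : {s : Set Y // P s}, (Z : Set Y) ⊆ (φ Z : Set Y)) ∧
      ∀ W ∈ irreducibleComponents Y, ∃! Z : Set Y, P Z ∧ Z ⊆ W := by
  have hspec : ∀ s t : PrimeSpectrum T, e s ⤳ e t ↔ s.asIdeal ≤ t.asIdeal := by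
    intro s t
    rw [he.isInducing.specializes_iff, ← PrimeSpectrum.le_iff_specializes]
    rfl
  have hp' : ∀ (t : PrimeSpectrum T) (d : PrimeSpectrum A), p (e t) = i d ↔ t.asIdeal.comap a = d.asIdeal := by
    intro t d
    rw [hcomm, hi.injective.eq_iff, PrimeSpectrum.ext_iff]
    rfl
  have hinc : ∀ (d : PrimeSpectrum A) (z z' : Y), p z = i d → p z' = i d → z ⤳ z' → z = z' := by
    intro d z z' h h' hs
    obtain ⟨s, rfl⟩ := hrange z ⟨d, h.symm⟩
    obtain ⟨t, rfl⟩ := hrange z' ⟨d, h'.symm⟩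
    congr 1
    have := s.isPrime
    exact PrimeSpectrum.ext (incomp a ha ((hspec _ _).mp hs)
      (((hp' _ _).mp h).trans ((hp' _ _).mp h').symm))
  refine comp_bij p hp hg (i c) (i ⊥) hξ (hinc c) (hinc ⊥) ?_ ?_ P hP
  · intro z hz
    obtain ⟨w, rfl⟩ := hrange z ⟨⊥, hz.symm⟩
    obtain ⟨η, ⟨h1, h2, h3⟩, h6⟩ := h4 w.asIdeal w.isPrime ((hp' _ _).mp hz)
    refine ⟨e ⟨η, h1⟩, ⟨(hspec _ _).mpr h2, (hp' _ _).mpr h3⟩, ?_⟩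
    rintro z' ⟨h7, h8⟩
    obtain ⟨t, rfl⟩ := hrange z' ⟨c, h8.symm⟩
    congr 1
    exact PrimeSpectrum.ext (h6 t.asIdeal ⟨t.isPrime, (hspec _ _).mp h7, (hp' _ _).mp h8⟩)
  · intro z hz
    obtain ⟨η, rfl⟩ := hrange z ⟨c, hz.symm⟩
    obtain ⟨w, ⟨h1, h2, h3⟩, h6⟩ := h5 η.asIdeal η.isPrime ((hp' _ _).mp hz)
    refine ⟨e ⟨w, h1⟩, ⟨(hspec _ _).mpr h2, (hp' _ ⊥).mpr h3⟩, ?_⟩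
    rintro z' ⟨h7, h8⟩
    obtain ⟨t, rfl⟩ := hrange z' ⟨⊥, h8.symm⟩
    congr 1
    exact PrimeSpectrum.ext (h6 t.asIdeal ⟨t.isPrime, (hspec _ _).mp h7, (hp' _ _).mp h8⟩)
end Hit

end

section
open AlgebraicGeometry CategoryTheory CategoryTheory.Limits
open scoped TensorProduct
namespace Hit
set_option linter.style.haveILetI false

theorem chart (K Kbar : Type u) [Field K] [Field Kbar] [Algebra K Kbar]
    (X : Scheme.{u}) (f : X ⟶ Spec (CommRingCat.of K)) (A : Type u) [CommRing A] [Algebra K A]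
    (i : Spec (CommRingCat.of A) ⟶ X) [IsPreimmersion i]
    (hif : i ≫ f = Spec.map (CommRingCat.ofHom (algebraMap K A))) :
    ∃ e : Spec (CommRingCat.of (A ⊗[K] Kbar)) ⟶
        pullback f (Spec.map (CommRingCat.ofHom (algebraMap K Kbar))),
      Topology.IsEmbedding e ∧
      (∀ t, pullback.fst f (Spec.map (CommRingCat.ofHom (algebraMap K Kbar))) (e t) =
        i (Spec.map (CommRingCat.ofHom (algebraMap A (A ⊗[K] Kbar))) t)) ∧
      ∀ z, pullback.fst f (Spec.map (CommRingCat.ofHom (algebraMap K Kbar))) z ∈ Set.range i →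
        z ∈ Set.range e := by
  let g : Spec (CommRingCat.of Kbar) ⟶ Spec (CommRingCat.of K) :=
      Spec.map (CommRingCat.ofHom (algebraMap K Kbar))
  let e₀ := (pullbackSpecIso K A Kbar).symm ≪≫ (pullback.congrHom hif.symm rfl) ≪≫
    (pullbackRightPullbackFstIso f g i).symm
  let e := e₀.hom ≫ pullback.snd i (pullback.fst f g)
  have hcomm : e ≫ pullback.fst f g = Spec.map (CommRingCat.ofHom (algebraMap A (A ⊗[K] Kbar))) ≫ i := by
    have h1 : e₀.hom ≫ pullback.fst i (pullback.fst f g) =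
        Spec.map (CommRingCat.ofHom (algebraMap A (A ⊗[K] Kbar))) := by
      have := pullbackSpecIso_inv_fst K A Kbar
      have hc : (pullback.congrHom hif.symm (rfl : g = g)).hom ≫ pullback.fst (i ≫ f) g =
          pullback.fst _ _ := by
        rw [pullback.congrHom_hom]
        exact (pullback.lift_fst _ _ _).trans (Category.comp_id _)
      change ((pullbackSpecIso K A Kbar).inv ≫ (pullback.congrHom hif.symm (rfl : g = g)).hom ≫
        (pullbackRightPullbackFstIso f g i).inv) ≫ _ = _
      rw [Category.assoc, Category.assoc, pullbackRightPullbackFstIso_inv_fst, hc]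
      exact this
    rw [← h1, Category.assoc, Category.assoc, pullback.condition]
  refine ⟨e, ?_, ?_, ?_⟩
  · exact e.isEmbedding
  · intro t
    have := congrArg (fun m => m t) hcomm
    simpa using this
  · intro z hz
    have h1 : z ∈ Set.range (pullback.snd i (pullback.fst f g)) := by
      rw [Scheme.Pullback.range_snd]; exact hz
    obtain ⟨t, rfl⟩ := h1
    obtain ⟨s, rfl⟩ := e₀.hom.surjective t
    exact ⟨s, by simp [e]⟩

end Hit

end

section
open AlgebraicGeometry CategoryTheory CategoryTheory.Limits
open scoped TensorProduct
namespace Hit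
set_option linter.style.haveILetI false

theorem spec_le {X : Scheme.{u}} {B : Type u} [CommRing B] (j : Spec (CommRingCat.of B) ⟶ X)
    [IsPreimmersion j] (a b : PrimeSpectrum B) :
    (j a ⤳ j b) ↔ a.asIdeal ≤ b.asIdeal := by
  refine (j.isEmbedding.isInducing.specializes_iff).trans ?_
  exact (PrimeSpectrum.le_iff_specializes a b).symm

theorem exists_chart {K : Type u} [Field K] {X : Scheme.{u}} (f : X ⟶ Spec (CommRingCat.of K))
    [LocallyOfFiniteType f] (x : X) (O : Set X) (hO : IsOpen O) (hx : x ∈ O) :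
    ∃ (B : Type u) (_ : CommRing B) (_ : Algebra K B) (j : Spec (CommRingCat.of B) ⟶ X),
      IsOpenImmersion j ∧ j ≫ f = Spec.map (CommRingCat.ofHom (algebraMap K B)) ∧
      Algebra.FiniteType K B ∧ x ∈ Set.range j ∧ Set.range j ⊆ O := by
  obtain ⟨U, hU, hxU, hUO⟩ := exists_isAffineOpen_mem_and_subset (x := x) (U := ⟨O, hO⟩) hx
  let α : K →+* Γ(X, U) := (Spec.preimage (hU.fromSpec ≫ f)).hom
  have hα : hU.fromSpec ≫ f = Spec.map (CommRingCat.ofHom α) := by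
    exact (Spec.map_preimage (hU.fromSpec ≫ f)).symm
  refine ⟨Γ(X, U), inferInstance, α.toAlgebra, hU.fromSpec, inferInstance, hα, ?_, ?_, ?_⟩
  · have : LocallyOfFiniteType (Spec.map (CommRingCat.ofHom α)) := by
      rw [← hα]; infer_instance
    exact (HasRingHomProperty.Spec_iff (P := @LocallyOfFiniteType)).mp this
  · rw [hU.range_fromSpec]; exact hxU
  · rw [hU.range_fromSpec]; exact hUO

theorem lift_chart {K : Type u} [Field K] {X : Scheme.{u}} (f : X ⟶ Spec (CommRingCat.of K))
    {B D : Type u} [CommRing B] [Algebra K B] [CommRing D] [Algebra K D]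
    (j : Spec (CommRingCat.of B) ⟶ X) [IsOpenImmersion j]
    (hj : j ≫ f = Spec.map (CommRingCat.ofHom (algebraMap K B)))
    (h : Spec (CommRingCat.of D) ⟶ X)
    (hh : h ≫ f = Spec.map (CommRingCat.ofHom (algebraMap K D)))
    (hr : Set.range h ⊆ Set.range j) :
    ∃ φ : B →ₐ[K] D, ∀ t : PrimeSpectrum D, j (PrimeSpectrum.comap (φ : B →+* D) t) = h t := by
  let l := IsOpenImmersion.lift j h hr
  have hl : l ≫ j = h := IsOpenImmersion.lift_fac j h hr
  let φ : CommRingCat.of B ⟶ CommRingCat.of D := Spec.preimage l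
  have hφ : Spec.map φ = l := Spec.map_preimage l
  have hK : CommRingCat.ofHom (algebraMap K B) ≫ φ = CommRingCat.ofHom (algebraMap K D) := by
    apply Spec.map_injective
    rw [Spec.map_comp, hφ, ← hj, ← hh, ← hl, Category.assoc]
  refine ⟨{ φ.hom with commutes' := fun r => ?_ }, fun t => ?_⟩
  · exact congrArg (fun m => m.hom r) hK
  · have h1 : (l ≫ j) t = h t := by rw [hl]
    rw [← h1, ← hφ]
    rfl

theorem descend {K B A k : Type u} [Field K] [CommRing B] [CommRing A] [CommRing k] [Algebra K B]
    [Algebra K A] [Algebra K k] (φ : B →ₐ[K] A) (ψ : B →ₐ[K] k)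
    (h : ∀ b, φ b = 0 → ψ b = 0) :
    ∃ β : φ.range →ₐ[K] k, ∀ b, β ⟨φ b, ⟨b, rfl⟩⟩ = ψ b := by
  let e := Ideal.quotientKerEquivRange φ
  refine ⟨(Ideal.Quotient.liftₐ (RingHom.ker φ) ψ (fun a ha => h a ha)).comp
    (e.symm : φ.range →ₐ[K] _), fun b => ?_⟩
  have : e.symm ⟨φ b, ⟨b, rfl⟩⟩ = Ideal.Quotient.mk _ b := by
    rw [AlgEquiv.symm_apply_eq]; rfl
  change Ideal.Quotient.liftₐ (RingHom.ker φ) ψ (fun a ha => h a ha) (e.symm ⟨φ b, ⟨b, rfl⟩⟩) = ψ b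
  rw [this]
  rfl

end Hit

end

section
open AlgebraicGeometry CategoryTheory CategoryTheory.Limits
open scoped TensorProduct
namespace Hit
set_option linter.style.haveILetI false

/-- the generic chart -/
theorem generic_chart {K : Type u} [Field K] {X : Scheme.{u}} (f : X ⟶ Spec (CommRingCat.of K))
    [LocallyOfFiniteType f] [IrreducibleSpace X] (hdim : 1 ≤ topologicalKrullDim X)
    (O : Set X) (hO : IsOpen O) (hne : genericPoint X ∈ O) :
    ∃ (A : Type u) (_ : CommRing A) (_ : IsDomain A) (_ : Algebra K A)
      (i : Spec (CommRingCat.of A) ⟶ X),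
      IsPreimmersion i ∧ i ≫ f = Spec.map (CommRingCat.ofHom (algebraMap K A)) ∧
      Algebra.FiniteType K A ∧ Set.range i ⊆ O ∧ i (⊥ : PrimeSpectrum A) = genericPoint X ∧
      ¬ IsField A := by
  obtain ⟨R, _, _, j, _, hj, hft, ⟨r, hr⟩, hjO⟩ := exists_chart f (genericPoint X) O hO hne
  let r' : PrimeSpectrum R := r
  have hspec : ∀ z : X, genericPoint X ⤳ z := fun z => genericPoint_specializes z
  let q : Ideal R := r'.asIdeal
  have hqp : q.IsPrime := r'.isPrime
  have hsurj : Function.Surjective (Ideal.Quotient.mk q) := Ideal.Quotient.mk_surjective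
  let π : CommRingCat.of R ⟶ CommRingCat.of (R ⧸ q) := CommRingCat.ofHom (Ideal.Quotient.mk q)
  have hπ : IsClosedImmersion (Spec.map π) := IsClosedImmersion.spec_of_surjective _ hsurj
  have hπr : ∀ t : PrimeSpectrum (R ⧸ q), Set.range (Spec.map π ≫ j) ⊆ Set.range j := by
    rintro t _ ⟨s, rfl⟩
    exact ⟨Spec.map π s, by simp⟩
  refine ⟨R ⧸ q, inferInstance, inferInstance, inferInstance, Spec.map π ≫ j, inferInstance, ?_,
    Algebra.FiniteType.of_surjective (Ideal.Quotient.mkₐ K q) hsurj, ?_, ?_, ?_⟩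
  · rw [Category.assoc, hj, ← Spec.map_comp]
    rfl
  · exact (hπr ⊥).trans hjO
  · rw [← hr]
    have : (Spec.map π) (⊥ : PrimeSpectrum (R ⧸ q)) = r := by
      apply PrimeSpectrum.ext
      change Ideal.comap (Ideal.Quotient.mk q) ⊥ = q
      rw [← RingHom.ker_eq_comap_bot, Ideal.mk_ker]
    exact (Scheme.Hom.comp_apply _ _ _).trans (congrArg j this)
  · intro hF
    have hqm : q.IsMaximal := (Ideal.Quotient.maximal_ideal_iff_isField_quotient q).mpr hF
    have hrange : ∀ z ∈ Set.range j, z = genericPoint X := by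
      rintro _ ⟨t, rfl⟩
      have h1 : j r' ⤳ j t := by
        have := hspec (j t)
        rw [← hr] at this; exact this
      have h2 := (spec_le j r' t).mp h1
      rw [← hr]
      congr 1
      exact PrimeSpectrum.ext (hqm.eq_of_le (PrimeSpectrum.isPrime (R := R) t).ne_top h2).symm
    have hJ : JacobsonSpace X := LocallyOfFiniteType.jacobsonSpace f
    have hd : Dense (closedPoints X) := by
      rw [dense_iff_closure_eq]; exact closure_closedPoints
    obtain ⟨z, hz, hzc⟩ := hd.inter_open_nonempty _ j.isOpenEmbedding.isOpen_range
      ⟨_, ⟨r, rfl⟩⟩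
    obtain rfl := hrange z hz
    have hcl : IsClosed {genericPoint X} := hzc
    have hall : ∀ z : X, z = genericPoint X := by
      intro z
      have := (hspec z).mem_closed hcl rfl
      exact this
    haveI : Subsingleton X := ⟨fun a b => (hall a).trans (hall b).symm⟩
    haveI : DiscreteTopology X := inferInstance
    have h0 := topologicalKrullDim_zero_of_discreteTopology X
    exact absurd (hdim.trans h0) (by decide)

end Hit

end

section
open AlgebraicGeometry CategoryTheory CategoryTheory.Limits
open scoped TensorProduct
namespace Hit
set_option linter.style.haveILetI false

theorem dim_curve {K : Type u} [Field K] {X : Scheme.{u}} (f : X ⟶ Spec (CommRingCat.of K))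
    [LocallyOfFiniteType f] {A : Type u} [CommRing A] [Algebra K A]
    (i : Spec (CommRingCat.of A) ⟶ X) [IsPreimmersion i]
    (hif : i ≫ f = Spec.map (CommRingCat.ofHom (algebraMap K A)))
    (c : PrimeSpectrum A) (hc : ¬ c.asIdeal.IsMaximal)
    (htr : Algebra.trdeg K (A ⧸ c.asIdeal) ≤ 1) :
    topologicalKrullDim (closure ({i c} : Set X)) = 1 := by
  apply dimOneTop
  · obtain ⟨m, hm, hcm⟩ := Ideal.exists_le_maximal c.asIdeal c.isPrime.ne_top
    let m' : PrimeSpectrum A := ⟨m, hm.isPrime⟩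
    refine ⟨i m', (spec_le i c m').mpr hcm, fun h => hc ?_⟩
    have h1 : m' = c := i.isEmbedding.injective h
    rw [← h1]; exact hm
  · intro z z' hyz hzz'
    obtain ⟨B, _, _, j, _, hj, hft, hz'j, -⟩ := exists_chart f z' Set.univ isOpen_univ trivial
    have hop : IsOpen (Set.range j) := j.isOpenEmbedding.isOpen_range
    have hzj := hzz'.mem_open hop hz'j
    have hyj := hyz.mem_open hop hzj
    obtain ⟨b', rfl⟩ := hz'j
    obtain ⟨b, rfl⟩ := hzj
    let κ := FractionRing (A ⧸ c.asIdeal)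
    let ρA : A →ₐ[K] κ := (Algebra.algHom K (A ⧸ c.asIdeal) κ).comp (Ideal.Quotient.mkₐ K c.asIdeal)
    have hρ : ∀ a, ρA a = algebraMap (A ⧸ c.asIdeal) κ (Ideal.Quotient.mk _ a) := fun a => rfl
    have hker : RingHom.ker ρA = c.asIdeal := by
      ext a
      rw [RingHom.mem_ker, hρ, FaithfulSMul.algebraMap_eq_zero_iff, Ideal.Quotient.eq_zero_iff_mem]
    have hpt : ∀ t : PrimeSpectrum κ, PrimeSpectrum.comap (ρA : A →+* κ) t = c := by
      intro t
      obtain rfl : t = ⊥ := Subsingleton.elim _ _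
      apply PrimeSpectrum.ext
      change Ideal.comap (ρA : A →+* κ) ⊥ = c.asIdeal
      rw [← RingHom.ker_eq_comap_bot]; exact hker
    let h : Spec (CommRingCat.of κ) ⟶ X := Spec.map (CommRingCat.ofHom (ρA : A →+* κ)) ≫ i
    have hh : ∀ t : PrimeSpectrum κ, h t = i c := by
      intro t
      refine (Scheme.Hom.comp_apply _ _ _).trans (congrArg i (hpt t))
    obtain ⟨ρB, hρB⟩ := lift_chart f j hj h (by
      rw [Category.assoc, hif, ← Spec.map_comp, ← CommRingCat.ofHom_comp]
      congr 2) (by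
      rintro _ ⟨t, rfl⟩
      rw [hh t]; exact hyj)
    let d : PrimeSpectrum B := PrimeSpectrum.comap (ρB : B →+* κ) ⊥
    have hd : d.asIdeal = RingHom.ker ρB := by
      change Ideal.comap (ρB : B →+* κ) ⊥ = _
      rw [← RingHom.ker_eq_comap_bot]; rfl
    have hjd : j d = i c := (hρB ⊥).trans (hh ⊥)
    rw [← hjd] at hyz ⊢
    have h1 := (spec_le j d b).mp hyz
    have h2 := (spec_le j b b').mp hzz'
    by_cases hdb : d.asIdeal = PrimeSpectrum.asIdeal (R := B) b
    · left
      exact congrArg j (PrimeSpectrum.ext hdb).symm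
    · right
      haveI := PrimeSpectrum.isPrime (R := B) b
      have hmax := dimB (K := K) ρA ρB (by rw [hker]; exact htr) (by
        intro z
        obtain ⟨a, s, hs⟩ := IsFractionRing.div_surjective (A := A ⧸ c.asIdeal) z
        obtain ⟨a, rfl⟩ := Ideal.Quotient.mk_surjective a
        obtain ⟨s, rfl⟩ := Ideal.Quotient.mk_surjective s
        have hs0 : ρA s ≠ 0 := by
          rw [hρ]
          exact IsFractionRing.to_map_ne_zero_of_mem_nonZeroDivisors hs.1
        refine ⟨a, s, hs0, ?_⟩
        rw [← hs.2, ← hρ, ← hρ, mul_div_cancel₀ _ hs0]) (PrimeSpectrum.asIdeal (R := B) b)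
        (by rw [← hd]; exact h1) (by rw [← hd]; exact hdb)
      exact congrArg j (PrimeSpectrum.ext
        (hmax.eq_of_le (PrimeSpectrum.isPrime (R := B) b').ne_top h2))

end Hit

end


open AlgebraicGeometry CategoryTheory CategoryTheory.Limits

/-- **Bertini–Charles–Poonen, with control of geometric components**: there is a
closed integral curve `C ⊆ X` through the images of the given `K̄`-points such that
the irreducible components of `p⁻¹(C) ⊆ X_K̄` are in bijection with the irreducible
components of `X_K̄`, every irreducible component of `p⁻¹(C)` being contained in the
corresponding component of `X_K̄`, and every component of `X_K̄` containing exactly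
one component of `p⁻¹(C)`. -/
theorem curve_through_points_bijective_components
    (K Kbar : Type u) [Field K] [Field Kbar] [Algebra K Kbar] [IsAlgClosure K Kbar]
    (X : Scheme.{u}) (f : X ⟶ Spec (CommRingCat.of K))
    [QuasiCompact f] [LocallyOfFiniteType f] [IsSeparated f]
    [IrreducibleSpace X] (hdim : 1 ≤ topologicalKrullDim X)
    (n : ℕ) (x : Fin n → (Spec (CommRingCat.of Kbar) ⟶ X))
    (hx : ∀ i, x i ≫ f = Spec.map (CommRingCat.ofHom (algebraMap K Kbar))) :
    let g : Spec (CommRingCat.of Kbar) ⟶ Spec (CommRingCat.of K) :=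
      Spec.map (CommRingCat.ofHom (algebraMap K Kbar))
    let XK : Scheme.{u} := pullback f g
    let p : XK → X := (pullback.fst f g).base
    ∃ C : Set X, IsClosed C ∧ IsIrreducible C ∧ topologicalKrullDim C = 1 ∧
      (∀ (i : Fin n) (y : Spec (CommRingCat.of Kbar)), (x i).base y ∈ C) ∧
      ∃ φ : {s : Set XK // IsIrreducibleComponentIn (p ⁻¹' C) s} ≃
            {s : Set XK // s ∈ irreducibleComponents XK},
        (∀ Z : {s : Set XK // IsIrreducibleComponentIn (p ⁻¹' C) s},
          (Z : Set XK) ⊆ ((φ Z : Set XK))) ∧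
        ∀ W ∈ irreducibleComponents XK,
          ∃! Z : Set XK, IsIrreducibleComponentIn (p ⁻¹' C) Z ∧ Z ⊆ W := by
  intro g XK p
  have : Algebra.IsAlgebraic K Kbar := IsAlgClosure.isAlgebraic
  have : IsAlgClosed Kbar := IsAlgClosure.isAlgClosed K
  have hgen : ∀ z : X, genericPoint X ⤳ z := fun z => genericPoint_specializes z
  let pt : PrimeSpectrum Kbar := ⊥
  have hpt : ∀ y : PrimeSpectrum Kbar, y = pt := fun y => Subsingleton.elim _ _
  have hV := fun i => Hit.exists_chart f (x i pt) Set.univ isOpen_univ trivial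
  choose B hB1 hB2 j hj1 hj2 hj3 hj4 _ using hV
  have hjo : ∀ i, IsOpen (Set.range (j i)) := fun i => (j i).isOpenEmbedding.isOpen_range
  obtain ⟨A, _, _, _, ι, _, hιf, hft, hιO, hιξ, hA⟩ := Hit.generic_chart f hdim
    (⋂ i, Set.range (j i)) (isOpen_iInter_of_finite hjo)
    (Set.mem_iInter.mpr fun i => (hgen _).mem_open (hjo i) (hj4 i))
  have hφ := fun i => Hit.lift_chart f (j i) (hj2 i) ι hιf
    (hιO.trans (Set.iInter_subset _ i))
  choose φ hφ using hφ
  have hψ := fun i => Hit.lift_chart f (j i) (hj2 i) (x i) (hx i) (by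
    rintro _ ⟨y, rfl⟩
    have := hj4 i
    rw [← hpt y] at this
    exact this)
  choose ψ hψ using hψ
  have hβ := fun i => Hit.descend (φ i) (ψ i) (by
    have h1 : ι (⊥ : PrimeSpectrum A) ⤳ x i pt := by rw [hιξ]; exact hgen _
    rw [← hφ i, ← hψ i] at h1
    have h2 := (Hit.spec_le (j i) _ _).mp h1
    intro b hb
    exact h2 (show (φ i) b ∈ (⊥ : Ideal A) from hb))
  choose β hβ using hβ
  obtain ⟨c, hcp, hcm, hcβ, htr, h4, h5⟩ := Hit.ALG (k := Kbar) hA (fun i => (φ i).range)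
    (fun i => by
      rw [← Algebra.map_top]
      exact (hj3 i).out.map _) β
  let c' : PrimeSpectrum A := ⟨c, hcp⟩
  obtain ⟨e, he1, he2, he3⟩ := Hit.chart K Kbar X f A ι hιf
  have : Flat g := by
    rw [Flat.SpecMap_iff]
    exact RingHom.Flat.of_isField (Field.toIsField K) _
  refine ⟨closure {ι c'}, isClosed_closure, isIrreducible_singleton.closure,
    Hit.dim_curve f ι hιf c' hcm htr, ?_, ?_⟩
  · intro i y
    have h1 : ∀ y : PrimeSpectrum Kbar, ι c' ⤳ x i y := by
      intro y
      rw [← hφ i, ← hψ i]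
      refine (Hit.spec_le (j i) _ _).mpr ?_
      intro b hb
      have h2 := hcβ i ⟨φ i b, ⟨b, rfl⟩⟩ hb
      rw [hβ] at h2
      change (ψ i) b ∈ PrimeSpectrum.asIdeal (R := Kbar) y
      rw [h2]; exact zero_mem _
    exact (h1 y).mem_closure
  · exact Hit.comp_bij_chart p (pullback.fst f g).continuous (Flat.generalizingMap _)
      (algebraMap A (TensorProduct K A Kbar)) (algebraMap_isIntegral_iff.mpr inferInstance)
      ι ι.isEmbedding e he1 he2 he3 c' (by rw [hιξ]; exact hgen) h4 h5
      (IsIrreducibleComponentIn (p ⁻¹' closure {ι c'})) (fun s => Iff.rfl)
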